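/- arXiv:2001.10747 — 2 statements merged into one kernel-verified Lean document; each statement's English description precedes it below -/
import Mathlib

section
/- Let R be a commutative semihereditary ring such that the class 𝒫₁(R) is covering. Then for every prime ideal 𝔭 of R the localisation R_𝔭 is a discrete valuation domain or a field; moreover every R_𝔭-module, viewed as an R-module, has projective dimension at most 1 over R, and consequently every maximal ideal of R is projective. -/
universe u

open MulOpposite Function

/-- An `A`-module `M` has projective dimension at most 1, i.e. there is a short exact
sequence `0 → ker g → P → M → 0` with `P` and `ker g` projective. -/
def ProjDimLE1 (A : Type u) [Ring A] (M : Type u) [AddCommGroup M] [Module A M] : Prop :=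
  ∃ (P : ModuleCat.{u} A) (g : P →ₗ[A] M), Module.Projective A P ∧
    Function.Surjective g ∧ Module.Projective A (LinearMap.ker g)

/-- `Ext¹_A(X, Y) = 0`: every short exact sequence `0 → Y → E → X → 0` splits. -/
def Ext1Vanishes (A : Type u) [Ring A] (X Y : Type u) [AddCommGroup X] [Module A X]
    [AddCommGroup Y] [Module A Y] : Prop :=
  ∀ (E : Type u) [AddCommGroup E] [Module A E], ∀ (i : Y →ₗ[A] E) (p : E →ₗ[A] X),
    Function.Injective i → Function.Surjective p → LinearMap.range i = LinearMap.ker p →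
    ∃ s : X →ₗ[A] E, p.comp s = LinearMap.id

/-- `φ : P → M` is a `C`-cover of `M`: `P ∈ C`, every map from a module of `C` to `M`
factors through `φ`, and every endomorphism `e` of `P` with `φ ∘ e = φ` is an automorphism. -/
def IsCover (A : Type u) [Ring A] (C : Set (ModuleCat.{u} A)) (P : ModuleCat.{u} A)
    (M : Type u) [AddCommGroup M] [Module A M] (φ : P →ₗ[A] M) : Prop :=
  P ∈ C ∧
  (∀ P' ∈ C, ∀ ψ : (P' : Type u) →ₗ[A] M, ∃ h : (P' : Type u) →ₗ[A] (P : Type u),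
    φ.comp h = ψ) ∧
  (∀ e : (P : Type u) →ₗ[A] (P : Type u), φ.comp e = φ → Function.Bijective e)

/-- The class `C` is covering: every `A`-module admits a `C`-cover. -/
def IsCoveringClass (A : Type u) [Ring A] (C : Set (ModuleCat.{u} A)) : Prop :=
  ∀ M : ModuleCat.{u} A, ∃ (P : ModuleCat.{u} A) (φ : P →ₗ[A] (M : Type u)),
    IsCover A C P (M : Type u) φ

/-- The class `𝒫₁(A)` of modules of projective dimension at most one. -/
def P1Class (A : Type u) [Ring A] : Set (ModuleCat.{u} A) := {M | ProjDimLE1 A M}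

section tight
variable {V : Type*} [CommRing V] [IsDomain V] {X Y : Type*}

lemma exists_fin_span {L : Type*} [AddCommGroup L] [Module V L] {ι : Type*} [Finite ι]
    (N : Submodule V L) (p : L →ₗ[V] (ι → V)) :
    ∃ s : Finset L, (∀ g ∈ s, g ∈ N) ∧ ∀ g ∈ N, ∃ v : V, v ≠ 0 ∧ ∃ c : L → V,
      v • p g = ∑ i ∈ s, c i • p i := by
  classical
  let K := FractionRing V
  let j : (ι → V) →ₗ[V] (ι → K) := LinearMap.compLeft (Algebra.linearMap V K) ι
  have hj : Function.Injective j := by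
    intro a b h
    funext i
    exact IsFractionRing.injective V K (congrFun h i)
  have hfg : (Submodule.span K ((fun g => j (p g)) '' (N : Set L))).FG :=
    IsNoetherian.noetherian _
  obtain ⟨t, ht, hspan⟩ := (Submodule.fg_span_iff_fg_span_finset_subset _).1 hfg
  obtain ⟨s, hsN, rfl⟩ := Finset.subset_set_image_iff.1 ht
  refine ⟨s, fun g hg => hsN hg, fun g hg => ?_⟩
  have h1 : j (p g) ∈ Submodule.span K ((fun g => j (p g)) '' (s : Set L)) := by
    rw [← Finset.coe_image, ← hspan]
    exact Submodule.subset_span ⟨g, hg, rfl⟩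
  rw [Submodule.mem_span_image_finset_iff_exists_fun'] at h1
  obtain ⟨c, hc⟩ := h1
  obtain ⟨b, hb⟩ := IsLocalization.exist_integer_multiples (nonZeroDivisors V) s c
  choose! d hd using hb
  refine ⟨b, nonZeroDivisors.coe_ne_zero b, d, hj ?_⟩
  rw [map_smul, map_sum, ← hc, Finset.smul_sum]
  refine Finset.sum_congr rfl fun i hi => ?_
  rw [map_smul, ← smul_assoc, ← hd i hi, algebraMap_smul]

variable (φ : (Y →₀ V) →ₗ[V] (X →₀ V))

/-- tight subsets -/
def TGood (S : Set X) : Prop :=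
  ∀ h : Y →₀ V, φ h ∈ Finsupp.supported V V S →
    ∀ y ∈ h.support, φ (Finsupp.single y 1) ∈ Finsupp.supported V V S

variable {φ}

lemma TGood.fin {S : Set X} (hS : TGood φ S) (C : Finset X) :
    ∃ D : Finset Y, ∀ h : Y →₀ V, φ h ∈ Finsupp.supported V V (S ∪ C) →
      ∀ y ∈ h.support, y ∈ D ∨ φ (Finsupp.single y 1) ∈ Finsupp.supported V V S := by
  classical
  let p : (Y →₀ V) →ₗ[V] (C → V) :=
    LinearMap.pi fun c => (Finsupp.lapply (c : X)).comp φ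
  obtain ⟨s, hsN, hs⟩ := exists_fin_span ((Finsupp.supported V V (S ∪ C)).comap φ) p
  refine ⟨s.biUnion Finsupp.support, fun h hh y hy => ?_⟩
  obtain ⟨v, hv, c, hc⟩ := hs h hh
  rw [or_iff_not_imp_right]
  intro hny
  set h' := v • h - ∑ i ∈ s, c i • i with hh'
  have h1 : φ h' ∈ Finsupp.supported V V (S ∪ C) := by
    have : h' ∈ (Finsupp.supported V V (S ∪ C)).comap φ :=
      sub_mem (Submodule.smul_mem _ _ hh)
        (Submodule.sum_mem _ fun i hi => Submodule.smul_mem _ _ (hsN i hi))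
    exact this
  have h2 : p h' = 0 := by
    rw [hh', map_sub, map_smul, hc, map_sum]
    simp
  have h3 : φ h' ∈ Finsupp.supported V V S := by
    rw [Finsupp.mem_supported'] at h1 ⊢
    intro x hx
    by_cases hxC : x ∈ C
    · exact congrFun h2 ⟨x, hxC⟩
    · exact h1 x (by simp [hx, hxC])
  have h4 : h' y = 0 := by
    by_contra h0
    exact hny (hS h' h3 y (Finsupp.mem_support_iff.2 h0))
  have h5 : v * h y = ∑ i ∈ s, c i * i y := by
    have := h4
    simp only [hh', Finsupp.sub_apply, Finsupp.smul_apply, Finsupp.finsetSum_apply, sub_eq_zero, smul_eq_mul] at this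
    exact this
  have h6 : ∑ i ∈ s, c i * i y ≠ 0 := by
    rw [← h5]
    exact mul_ne_zero hv (Finsupp.mem_support_iff.1 hy)
  obtain ⟨i, hi, hi'⟩ := Finset.exists_ne_zero_of_sum_ne_zero h6
  exact Finset.mem_biUnion.2 ⟨i, hi, Finsupp.mem_support_iff.2 (right_ne_zero_of_mul hi')⟩

lemma TGood.step {S : Set X} (hS : TGood φ S) (C0 : Finset X) :
    ∃ E : Set X, E.Countable ∧ (C0 : Set X) ⊆ E ∧ TGood φ (S ∪ E) := by
  classical
  choose D hD using hS.fin
  obtain ⟨C, hC0, hC⟩ : ∃ C : ℕ → Finset X, C 0 = C0 ∧ ∀ n, C (n+1) =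
      C n ∪ (D (C n)).biUnion fun y => (φ (Finsupp.single y 1)).support :=
    ⟨fun n => Nat.rec C0
      (fun _ c => c ∪ (D c).biUnion fun y => (φ (Finsupp.single y 1)).support) n, rfl,
      fun n => rfl⟩
  have hmono : Monotone C := monotone_nat_of_le_succ fun n => by
    rw [hC]; exact Finset.subset_union_left
  have hE : ∀ x ∈ C0, x ∈ ⋃ n : ℕ, ((C n : Finset X) : Set X) := by
    intro x hx
    exact Set.mem_iUnion.2 ⟨0, by rw [hC0]; exact hx⟩
  refine ⟨⋃ n : ℕ, (C n : Set X), Set.countable_iUnion (fun n => (C n).countable_toSet),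
    fun x hx => hE x hx, fun h hh y hy => ?_⟩
  have h1 : ∃ n, φ h ∈ Finsupp.supported V V (S ∪ C n) := by
    rw [Finsupp.mem_supported] at hh
    have : ∀ t : Finset X, (t : Set X) ⊆ S ∪ ⋃ n : ℕ, (C n : Set X) →
        ∃ n, (t : Set X) ⊆ S ∪ (C n : Set X) := by
      intro t
      induction t using Finset.induction_on with
      | empty => intro _; exact ⟨0, by simp⟩
      | insert a t ha ih =>
        intro hs
        rw [Finset.coe_insert, Set.insert_subset_iff] at hs
        obtain ⟨n, hn⟩ := ih hs.2
        rcases hs.1 with h | h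
        · refine ⟨n, ?_⟩
          rw [Finset.coe_insert, Set.insert_subset_iff]
          exact ⟨Or.inl h, hn⟩
        · obtain ⟨m, hm⟩ := Set.mem_iUnion.1 h
          refine ⟨max n m, ?_⟩
          rw [Finset.coe_insert, Set.insert_subset_iff]
          refine ⟨Or.inr (hmono (le_max_right n m) hm), hn.trans ?_⟩
          exact Set.union_subset_union_right _ (hmono (le_max_left n m))
    obtain ⟨n, hn⟩ := this _ hh
    exact ⟨n, (Finsupp.mem_supported _ _).2 hn⟩
  obtain ⟨n, hn⟩ := h1
  rcases hD (C n) h hn y hy with h2 | h2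
  · rw [Finsupp.mem_supported]
    refine Set.Subset.trans ?_ (Set.subset_union_right)
    refine Set.Subset.trans ?_ (Set.subset_iUnion _ (n+1))
    rw [hC]
    intro x hx
    exact Finset.mem_union_right _ (Finset.mem_biUnion.2 ⟨y, h2, hx⟩)
  · exact Finsupp.supported_mono Set.subset_union_left h2

lemma colon_principal [ValuationRing V] {E : Type*} [AddCommGroup E] [Module V E]
    [Module.IsTorsionFree V E] (W : Submodule V E) (hW : W.FG) (z : E) :
    ∃ t : V, ∀ v : V, v • z ∈ W ↔ t ∣ v := by
  classical
  let U : Submodule V E := W ⊔ Submodule.span V {z}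
  have hU : U.FG := hW.sup (Submodule.fg_span_singleton z)
  have : Module.Finite V U := Module.Finite.of_fg hU
  have : Module.Flat V U := by
    rw [Module.Flat.flat_iff_torsion_eq_bot_of_isBezout, ← Submodule.isTorsionFree_iff_torsion_eq_bot]
    infer_instance
  have : Module.Free V U := Module.free_of_flat_of_isLocalRing
  have : Module.FinitePresentation V U := Module.finitePresentation_of_projective _ _
  let W' : Submodule V U := W.comap U.subtype
  have hW' : W'.FG := by
    have : W' = LinearMap.range (Submodule.inclusion (le_sup_left : W ≤ U)) := by
      rw [Submodule.range_inclusion]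
    rw [this]
    have : Module.Finite V W := Module.Finite.of_fg hW
    exact Module.Finite.iff_fg.1 inferInstance
  let l : V →ₗ[V] (U ⧸ W') :=
    W'.mkQ.comp (LinearMap.toSpanSingleton V U ⟨z, Submodule.mem_sup_right (Submodule.mem_span_singleton_self z)⟩)
  have hl : Function.Surjective l := by
    intro a
    obtain ⟨⟨b, hb⟩, rfl⟩ := W'.mkQ_surjective a
    obtain ⟨w, hw, c, hc, rfl⟩ := Submodule.mem_sup.1 hb
    obtain ⟨v, rfl⟩ := Submodule.mem_span_singleton.1 hc
    refine ⟨v, ?_⟩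
    simp only [l, LinearMap.comp_apply, Submodule.mkQ_apply]
    rw [Submodule.Quotient.eq]
    change _ ∈ W
    simpa using hw
  have : Module.FinitePresentation V (U ⧸ W') :=
    Module.finitePresentation_of_surjective W'.mkQ W'.mkQ_surjective (by rwa [Submodule.ker_mkQ])
  have hk : (LinearMap.ker l).FG := Module.FinitePresentation.fg_ker l hl
  obtain ⟨t, ht⟩ := (IsBezout.isPrincipal_of_FG (LinearMap.ker l) hk).principal
  refine ⟨t, fun v => ?_⟩
  have h1 : v • z ∈ W ↔ v ∈ LinearMap.ker l := by
    simp only [l, LinearMap.mem_ker, LinearMap.comp_apply, Submodule.mkQ_apply, Submodule.Quotient.mk_eq_zero]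
    rfl
  rw [h1, ht]
  exact Ideal.mem_span_singleton

lemma TGood.colon [ValuationRing V] {S : Set X} (hS : TGood φ S) (W : Submodule V (X →₀ V))
    (hW : W.FG) (z : X →₀ V) :
    ∃ t : V, ∀ v : V, v • z ∈ Finsupp.supported V V S ⊔ LinearMap.range φ ⊔ W ↔ t ∣ v := by
  classical
  obtain ⟨C, hC⟩ : ∃ C : Finset X, W ⊔ Submodule.span V {z} ≤ Finsupp.supported V V (C : Set X) := by
    obtain ⟨s, rfl⟩ := hW
    refine ⟨s.biUnion Finsupp.support ∪ z.support, sup_le (Submodule.span_le.2 ?_) (Submodule.span_le.2 ?_)⟩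
    · intro a ha
      refine (Finsupp.mem_supported _ _).2 ?_
      intro x hx
      exact Finset.mem_union_left _ (Finset.mem_biUnion.2 ⟨a, ha, hx⟩)
    · rintro a rfl
      refine (Finsupp.mem_supported _ _).2 ?_
      intro x hx
      exact Finset.mem_union_right _ hx
  obtain ⟨D, hD⟩ := hS.fin C
  let W' := W ⊔ Submodule.span V ((D.image fun y => φ (Finsupp.single y 1) : Finset _) : Set (X →₀ V))
  have hW' : W'.FG := hW.sup ⟨_, rfl⟩
  have key : ∀ v : V, v • z ∈ Finsupp.supported V V S ⊔ LinearMap.range φ ⊔ W ↔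
      v • z ∈ Finsupp.supported V V S ⊔ W' := by
    intro v
    constructor
    · intro h
      obtain ⟨a, ha, w, hw, haw⟩ := Submodule.mem_sup.1 h
      obtain ⟨f, hf, b, ⟨g, rfl⟩, rfl⟩ := Submodule.mem_sup.1 ha
      have h1 : φ g ∈ Finsupp.supported V V (S ∪ C) := by
        have : φ g = v • z - w - f := by rw [← haw]; abel
        rw [this]
        refine sub_mem (sub_mem ?_ ?_) (Finsupp.supported_mono Set.subset_union_left hf)
        · exact Finsupp.supported_mono Set.subset_union_right (hC (Submodule.smul_mem _ _ (Submodule.mem_sup_right (Submodule.mem_span_singleton_self z))))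
        · exact Finsupp.supported_mono Set.subset_union_right (hC (Submodule.mem_sup_left hw))
      have h2 : φ g ∈ Finsupp.supported V V S ⊔ W' := by
        have : g = ∑ y ∈ g.support, g y • Finsupp.single y (1 : V) := by
          conv_lhs => rw [← Finsupp.sum_single g]
          simp [Finsupp.sum]
        rw [this, map_sum]
        refine Submodule.sum_mem _ fun y hy => ?_
        rw [map_smul]
        refine Submodule.smul_mem _ _ ?_
        rcases hD g h1 y hy with h3 | h3
        · refine Submodule.mem_sup_right (Submodule.mem_sup_right (Submodule.subset_span ?_))
          exact Finset.mem_image_of_mem _ h3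
        · exact Submodule.mem_sup_left h3
      rw [← haw]
      exact add_mem (add_mem (Submodule.mem_sup_left hf) h2) (Submodule.mem_sup_right (Submodule.mem_sup_left hw))
    · intro h
      refine (show _ ≤ Finsupp.supported V V S ⊔ LinearMap.range φ ⊔ W from sup_le ?_ (sup_le ?_ (Submodule.span_le.2 ?_))) h
      · exact le_sup_left.trans le_sup_left
      · exact le_sup_right
      · intro a ha
        obtain ⟨y, hy, rfl⟩ := Finset.mem_image.1 (Finset.mem_coe.1 ha)
        exact Submodule.mem_sup_left (Submodule.mem_sup_right ⟨_, rfl⟩)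
  let ρ : (X →₀ V) →ₗ[V] (X →₀ V) :=
    { toFun := Finsupp.filter (· ∈ Sᶜ)
      map_add' := fun _ _ => Finsupp.filter_add
      map_smul' := fun _ _ => Finsupp.filter_smul }
  have hρ : ∀ a, ρ a = 0 ↔ a ∈ Finsupp.supported V V S := by
    intro a
    rw [Finsupp.mem_supported']
    constructor
    · intro h x hx
      have := DFunLike.congr_fun h x
      change Finsupp.filter (· ∈ Sᶜ) a x = 0 at this
      rwa [Finsupp.filter_apply_pos (· ∈ Sᶜ) _ hx] at this
    · intro h
      ext x
      change Finsupp.filter (· ∈ Sᶜ) a x = 0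
      by_cases hx : x ∈ S
      · exact Finsupp.filter_apply_neg _ _ (by simpa using hx)
      · rw [Finsupp.filter_apply_pos (· ∈ Sᶜ) _ hx]; exact h x hx
  obtain ⟨t, ht⟩ := colon_principal (W'.map ρ) (hW'.map ρ) (ρ z)
  refine ⟨t, fun v => ?_⟩
  rw [key, ← ht, ← map_smul]
  constructor
  · intro h
    obtain ⟨a, ha, w, hw, haw⟩ := Submodule.mem_sup.1 h
    refine ⟨w, hw, ?_⟩
    rw [← haw, map_add, (hρ a).2 ha, zero_add]
  · rintro ⟨w, hw, h⟩
    have : v • z - w ∈ Finsupp.supported V V S := by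
      rw [← hρ, map_sub, h, sub_self]
    have h2 := add_mem (Submodule.mem_sup_left (T := W') this) (Submodule.mem_sup_right hw)
    simpa using h2

variable {B : Type*} [AddCommGroup B] [Module V B]

lemma extend_one [ValuationRing V] (hB : ∀ t : V, t ≠ 0 → ∀ b : B, ∃ b', t • b' = b)
    {S : Set X} (hS : TGood φ S) (g : (X →₀ V) →ₗ.[V] B)
    (hg : ∃ W : Submodule V (X →₀ V), W.FG ∧
      g.domain = Finsupp.supported V V S ⊔ LinearMap.range φ ⊔ W) (z : X →₀ V) :
    ∃ g' : (X →₀ V) →ₗ.[V] B, g ≤ g' ∧ z ∈ g'.domain ∧ ∃ W : Submodule V (X →₀ V), W.FG ∧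
      g'.domain = Finsupp.supported V V S ⊔ LinearMap.range φ ⊔ W := by
  obtain ⟨W, hW, hdom⟩ := hg
  by_cases hz : z ∈ g.domain
  · exact ⟨g, le_rfl, hz, W, hW, hdom⟩
  have hz0 : z ≠ 0 := by
    rintro rfl; exact hz (zero_mem _)
  obtain ⟨t, ht⟩ := hS.colon W hW z
  rw [← hdom] at ht
  obtain ⟨b, hb⟩ : ∃ b : B, ∀ (v : V) (hv : v • z ∈ g.domain), g ⟨v • z, hv⟩ = v • b := by
    have htz : t • z ∈ g.domain := (ht t).2 dvd_rfl
    by_cases h0 : t = 0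
    · refine ⟨0, fun v hv => ?_⟩
      have : v = 0 := by
        have := (ht v).1 hv
        rw [h0] at this
        exact zero_dvd_iff.1 this
      subst this
      have : (⟨(0:V) • z, hv⟩ : g.domain) = 0 := by ext1; simp
      rw [this, g.map_zero, zero_smul]
    · obtain ⟨b, hb⟩ := hB t h0 (g ⟨t • z, htz⟩)
      refine ⟨b, fun v hv => ?_⟩
      obtain ⟨u, rfl⟩ := (ht v).1 hv
      have : (⟨(t * u) • z, hv⟩ : g.domain) = u • ⟨t • z, htz⟩ := by
        ext1; simp [smul_smul, mul_comm]
      rw [this, g.map_smul, ← hb, smul_smul, mul_comm]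
  let k : (X →₀ V) →ₗ.[V] B := LinearPMap.mkSpanSingleton' z b (by
    intro c hc
    rcases smul_eq_zero.1 hc with h | h
    · rw [h]; simp
    · exact absurd h hz0)
  have hk : ∀ (x : g.domain) (y : k.domain), (x : X →₀ V) = y → g x = k y := by
    rintro ⟨x, hx⟩ ⟨y, hy⟩ hxy
    simp only at hxy
    subst hxy
    obtain ⟨v, rfl⟩ := Submodule.mem_span_singleton.1 hy
    rw [hb v hx]
    exact (LinearPMap.mkSpanSingleton'_apply z b _ v hy).symm
  refine ⟨g.sup k hk, LinearPMap.left_le_sup _ _ _, ?_, W ⊔ Submodule.span V {z},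
    hW.sup (Submodule.fg_span_singleton z), ?_⟩
  · rw [LinearPMap.domain_sup]
    exact Submodule.mem_sup_right (Submodule.mem_span_singleton_self z)
  · rw [LinearPMap.domain_sup, hdom, sup_assoc]
    rfl

lemma extend_seq [ValuationRing V] (hB : ∀ t : V, t ≠ 0 → ∀ b : B, ∃ b', t • b' = b)
    {S : Set X} (hS : TGood φ S) (g : (X →₀ V) →ₗ.[V] B)
    (hg : ∃ W : Submodule V (X →₀ V), W.FG ∧
      g.domain = Finsupp.supported V V S ⊔ LinearMap.range φ ⊔ W) (E : Set X)
    (hE : E.Countable) :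
    ∃ g' : (X →₀ V) →ₗ.[V] B, g ≤ g' ∧ Finsupp.supported V V E ≤ g'.domain := by
  classical
  rcases E.eq_empty_or_nonempty with rfl | hne
  · exact ⟨g, le_rfl, by simp⟩
  obtain ⟨e, he⟩ := hE.exists_eq_range hne
  let T := {g : (X →₀ V) →ₗ.[V] B // ∃ W : Submodule V (X →₀ V), W.FG ∧
      g.domain = Finsupp.supported V V S ⊔ LinearMap.range φ ⊔ W}
  have hstep : ∀ (a : T) (z : X →₀ V), ∃ b : T, a.1 ≤ b.1 ∧ z ∈ b.1.domain := by
    rintro ⟨a, ha⟩ z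
    obtain ⟨b, h1, h2, h3⟩ := extend_one hB hS a ha z
    exact ⟨⟨b, h3⟩, h1, h2⟩
  choose nx hnx1 hnx2 using hstep
  let q : ℕ → T := fun n => Nat.rec ⟨g, hg⟩ (fun n a => nx a (Finsupp.single (e n) 1)) n
  have hq : ∀ n, q (n+1) = nx (q n) (Finsupp.single (e n) 1) := fun n => rfl
  have hmono : Monotone fun n => (q n).1 := monotone_nat_of_le_succ fun n => by
    rw [hq]; exact hnx1 _ _
  have hdir : DirectedOn (· ≤ ·) (Set.range fun n => (q n).1) :=
    directedOn_range.2 hmono.directed_le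
  refine ⟨LinearPMap.sSup _ hdir, LinearPMap.le_sSup hdir ⟨0, rfl⟩, ?_⟩
  rw [Finsupp.supported_eq_span_single, Submodule.span_le]
  rintro _ ⟨x, hx, rfl⟩
  rw [he] at hx
  obtain ⟨n, rfl⟩ := hx
  have h1 : (q (n+1)).1 ≤ LinearPMap.sSup _ hdir := LinearPMap.le_sSup hdir ⟨n+1, rfl⟩
  apply h1.1
  rw [hq]
  exact hnx2 _ _

lemma restrict_pmap {E : Type*} [AddCommGroup E] [Module V E] (g : E →ₗ.[V] B) (U : Submodule V E)
    (hU : U ≤ g.domain) : ∃ g' : E →ₗ.[V] B, g'.domain = U ∧ g' ≤ g ∧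
      ∀ k : E →ₗ.[V] B, k ≤ g → k.domain ≤ U → k ≤ g' := by
  refine ⟨⟨U, g.toFun.comp (Submodule.inclusion hU)⟩, rfl, ⟨hU, ?_⟩, fun k hk hkU => ⟨hkU, ?_⟩⟩
  · rintro ⟨x, hx⟩ ⟨y, hy⟩ hxy
    simp only at hxy
    subst hxy
    rfl
  · rintro ⟨x, hx⟩ ⟨y, hy⟩ hxy
    simp only at hxy
    subst hxy
    exact hk.2 rfl

lemma extend_total [ValuationRing V] (hB : ∀ t : V, t ≠ 0 → ∀ b : B, ∃ b', t • b' = b)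
    (hφ : Function.Injective φ) (z : X →₀ V) (g : (X →₀ V) →ₗ.[V] B)
    (hg : g.domain = LinearMap.range φ ⊔ Submodule.span V {z}) :
    ∃ g' : (X →₀ V) →ₗ.[V] B, g ≤ g' ∧ g'.domain = ⊤ := by
  classical
  have h0 : TGood φ (∅ : Set X) := by
    intro h hh y hy
    rw [Finsupp.supported_empty, Submodule.mem_bot] at hh
    have : h = 0 := hφ (by rw [hh, map_zero])
    rw [this] at hy
    simp at hy
  -- one step
  have hext : ∀ (S : Set X) (_ : TGood φ S) (k : (X →₀ V) →ₗ.[V] B)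
      (_ : ∃ W : Submodule V (X →₀ V), W.FG ∧
      k.domain = Finsupp.supported V V S ⊔ LinearMap.range φ ⊔ W) (C : Finset X)
      (_ : k.domain ≤ Finsupp.supported V V (S ∪ C) ⊔ LinearMap.range φ),
      ∃ S', TGood φ S' ∧ S ⊆ S' ∧ (C : Set X) ⊆ S' ∧ ∃ k' : (X →₀ V) →ₗ.[V] B, k ≤ k' ∧
        k'.domain = Finsupp.supported V V S' ⊔ LinearMap.range φ := by
    intro S hS k hk C hkC
    obtain ⟨E, hE, hCE, hSE⟩ := hS.step C
    obtain ⟨k1, hk1, hEk1⟩ := extend_seq hB hS k hk E hE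
    obtain ⟨W, hW, hkW⟩ := hk
    obtain ⟨k2, hk2, -, hk2'⟩ := restrict_pmap k1 (Finsupp.supported V V (S ∪ E) ⊔ LinearMap.range φ) (by
      rw [Finsupp.supported_union]
      refine sup_le (sup_le ?_ hEk1) ?_
      · refine le_trans ?_ hk1.1
        rw [hkW]
        exact le_sup_left.trans le_sup_left
      · refine le_trans ?_ hk1.1
        rw [hkW]
        exact le_sup_right.trans le_sup_left)
    refine ⟨S ∪ E, hSE, Set.subset_union_left, hCE.trans Set.subset_union_right, k2,
      hk2' k hk1 (hkC.trans (sup_le_sup_right (Finsupp.supported_mono ?_) _)), hk2⟩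
    exact Set.union_subset_union_right _ hCE
  obtain ⟨S1, hS1, -, -, g1, hg1, hg1d⟩ := hext ∅ h0 g ⟨Submodule.span V {z},
    Submodule.fg_span_singleton z, by rw [hg, Finsupp.supported_empty, bot_sup_eq]⟩ z.support (by
      rw [hg]
      refine sup_le le_sup_right (le_trans ?_ le_sup_left)
      rw [Submodule.span_le, Set.singleton_subset_iff]
      exact (Finsupp.mem_supported _ _).2 Set.subset_union_right)
  let P : Set (Set X × ((X →₀ V) →ₗ.[V] B)) :=
    {a | TGood φ a.1 ∧ a.2.domain = Finsupp.supported V V a.1 ⊔ LinearMap.range φ}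
  obtain ⟨m, hm1, hm⟩ := zorn_le_nonempty₀ P (by
    intro c hcP hc a hac
    have hdir : DirectedOn (· ≤ ·) (Prod.snd '' c) := by
      rintro _ ⟨a, ha, rfl⟩ _ ⟨b, hb, rfl⟩
      rcases hc.total ha hb with h | h
      · exact ⟨b.2, ⟨b, hb, rfl⟩, h.2, le_rfl⟩
      · exact ⟨a.2, ⟨a, ha, rfl⟩, le_rfl, h.2⟩
    refine ⟨(⋃ b ∈ c, b.1, LinearPMap.sSup _ hdir), ⟨?_, ?_⟩, ?_⟩
    · intro h hh y hy
      have : ∀ t : Finset X, (t : Set X) ⊆ ⋃ b ∈ c, b.1 → ∃ b ∈ c, (t : Set X) ⊆ b.1 := by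
        intro t
        induction t using Finset.induction_on with
        | empty => intro _; exact ⟨a, hac, by simp⟩
        | insert x t hx ih =>
          intro hs
          rw [Finset.coe_insert, Set.insert_subset_iff] at hs
          obtain ⟨b, hb, hbt⟩ := ih hs.2
          obtain ⟨b', hb', hx'⟩ := Set.mem_iUnion₂.1 hs.1
          rcases hc.total hb hb' with h | h
          · refine ⟨b', hb', ?_⟩
            rw [Finset.coe_insert, Set.insert_subset_iff]
            exact ⟨hx', hbt.trans h.1⟩
          · refine ⟨b, hb, ?_⟩
            rw [Finset.coe_insert, Set.insert_subset_iff]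
            exact ⟨h.1 hx', hbt⟩
      obtain ⟨b, hb, hb'⟩ := this _ ((Finsupp.mem_supported _ _).1 hh)
      have := (hcP hb).1 h ((Finsupp.mem_supported _ _).2 hb') y hy
      exact Finsupp.supported_mono (Set.subset_biUnion_of_mem (u := fun b => b.1) hb) this
    · apply le_antisymm
      · refine sSup_le ?_
        rintro _ ⟨_, ⟨b, hb, rfl⟩, rfl⟩
        rw [(hcP hb).2]
        exact sup_le_sup_right (Finsupp.supported_mono
          (Set.subset_biUnion_of_mem (u := fun b => b.1) hb)) _
      · refine sup_le ?_ ?_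
        · rw [Finsupp.supported_eq_span_single, Submodule.span_le]
          rintro _ ⟨x, hx, rfl⟩
          obtain ⟨b, hb, hx⟩ := Set.mem_iUnion₂.1 hx
          have h1 : b.2 ≤ LinearPMap.sSup _ hdir := LinearPMap.le_sSup hdir ⟨b, hb, rfl⟩
          apply h1.1
          rw [(hcP hb).2]
          exact Submodule.mem_sup_left (Finsupp.single_mem_supported _ _ hx)
        · have h1 : a.2 ≤ LinearPMap.sSup _ hdir := LinearPMap.le_sSup hdir ⟨a, hac, rfl⟩
          refine le_trans ?_ h1.1
          rw [(hcP hac).2]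
          exact le_sup_right
    · intro b hb
      exact ⟨Set.subset_biUnion_of_mem (u := fun b => b.1) hb, LinearPMap.le_sSup hdir ⟨b, hb, rfl⟩⟩)
    (S1, g1) ⟨hS1, hg1d⟩
  refine ⟨m.2, hg1.trans hm1.2, ?_⟩
  have huniv : m.1 = Set.univ := by
    rw [Set.eq_univ_iff_forall]
    intro x
    obtain ⟨S', hS', hSS', hxS', k', hk', hk'd⟩ := hext m.1 hm.prop.1 m.2 ⟨⊥, Submodule.fg_bot, by
      rw [sup_bot_eq]; exact hm.prop.2⟩ {x} (by
        rw [hm.prop.2]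
        exact sup_le_sup_right (Finsupp.supported_mono Set.subset_union_left) _)
    have := hm.le_of_ge (y := (S', k')) ⟨hS', hk'd⟩ ⟨hSS', hk'⟩
    exact this.1 (hxS' (by simp))
  rw [hm.prop.2, huniv, Finsupp.supported_univ, top_sup_eq]

/-- The key local splitting. -/
lemma local_split [ValuationRing V] {A : Type*} [AddCommGroup A] [Module V A]
    (hφ : Function.Injective φ) (q : (X →₀ V) →ₗ[V] A) (hq : Function.Surjective q)
    (hex : LinearMap.range φ = LinearMap.ker q) (B : Submodule V A)
    (hB : ∀ t : V, t ≠ 0 → ∀ b ∈ B, ∃ b' ∈ B, t • b' = b) (x : A) (hx : x ∈ B) :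
    ∃ θ : A →ₗ[V] A, (∀ a, θ a ∈ B) ∧ θ x = x := by
  obtain ⟨z, rfl⟩ := hq x
  let U := LinearMap.range φ ⊔ Submodule.span V {z}
  have hU : ∀ u : U, q u ∈ B := by
    rintro ⟨u, hu⟩
    have : U ≤ B.comap q := by
      refine sup_le ?_ ?_
      · rw [hex]
        intro a ha
        rw [Submodule.mem_comap, LinearMap.mem_ker.1 ha]
        exact zero_mem _
      · rw [Submodule.span_le, Set.singleton_subset_iff]
        exact hx
    exact this hu
  let g : (X →₀ V) →ₗ.[V] B := ⟨U, (q.comp U.subtype).codRestrict B hU⟩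
  obtain ⟨g', hgg', htop⟩ := extend_total (B := B) (by
    rintro t ht ⟨b, hb⟩
    obtain ⟨b', hb', h⟩ := hB t ht b hb
    exact ⟨⟨b', hb'⟩, by ext1; exact h⟩) hφ z g rfl
  let G : (X →₀ V) →ₗ[V] A := B.subtype.comp (g'.toFun.comp
    (Submodule.inclusion (show (⊤ : Submodule V (X →₀ V)) ≤ g'.domain from htop.ge) ∘ₗ
      (Submodule.topEquiv (R := V) (M := X →₀ V)).symm.toLinearMap))
  have hG : ∀ u : U, G u = q u := by
    intro u
    have : g u = g' ⟨u, htop.ge trivial⟩ := hgg'.2 rfl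
    exact (congrArg (B.subtype) this).symm
  refine ⟨((LinearMap.ker q).liftQ G ?_) ∘ₗ (q.quotKerEquivOfSurjective hq).symm.toLinearMap, ?_, ?_⟩
  · intro a ha
    rw [← hex] at ha
    rw [LinearMap.mem_ker, hG ⟨a, Submodule.mem_sup_left ha⟩]
    rw [hex] at ha
    exact ha
  · intro a
    obtain ⟨w, rfl⟩ := hq a
    have : (q.quotKerEquivOfSurjective hq).symm (q w) = (LinearMap.ker q).mkQ w := by
      rw [LinearEquiv.symm_apply_eq]; rfl
    simp only [LinearMap.comp_apply, LinearEquiv.coe_coe, this]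
    exact (g' _).2
  · have : (q.quotKerEquivOfSurjective hq).symm (q z) = (LinearMap.ker q).mkQ z := by
      rw [LinearEquiv.symm_apply_eq]; rfl
    simp only [LinearMap.comp_apply, LinearEquiv.coe_coe, this]
    exact hG ⟨z, Submodule.mem_sup_right (Submodule.mem_span_singleton_self z)⟩

lemma ann_principal [ValuationRing V] {A : Type*} [AddCommGroup A] [Module V A]
    (hφ : Function.Injective φ) (q : (X →₀ V) →ₗ[V] A) (hq : Function.Surjective q)
    (hex : LinearMap.range φ = LinearMap.ker q) (x : A) : ∃ t : V, ∀ v : V, v • x = 0 ↔ t ∣ v := by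
  have h0 : TGood φ (∅ : Set X) := by
    intro h hh y hy
    rw [Finsupp.supported_empty, Submodule.mem_bot] at hh
    have : h = 0 := hφ (by rw [hh, map_zero])
    rw [this] at hy
    simp at hy
  obtain ⟨z, rfl⟩ := hq x
  obtain ⟨t, ht⟩ := h0.colon ⊥ Submodule.fg_bot z
  refine ⟨t, fun v => ?_⟩
  rw [← ht, Finsupp.supported_empty, bot_sup_eq, sup_bot_eq, hex, LinearMap.mem_ker, map_smul]
end tight

lemma sh_idem {R : Type u} [CommRing R] (hsh : ∀ I : Ideal R, I.FG → Module.Projective R I)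
    (r : R) : ∃ c : R, c * r = r ∧ ∀ x, x * r = 0 → x * c = 0 := by
  have hP := hsh (Ideal.span {r}) (Submodule.fg_span_singleton r)
  have hr : r ∈ Ideal.span {r} := Ideal.mem_span_singleton_self r
  let f : R →ₗ[R] (Ideal.span {r} : Ideal R) := LinearMap.toSpanSingleton R _ ⟨r, hr⟩
  have hf : Surjective f := by
    rintro ⟨y, hy⟩
    obtain ⟨x, rfl⟩ := Ideal.mem_span_singleton'.1 hy
    exact ⟨x, by ext1; simp [f]⟩
  obtain ⟨s, hs⟩ := Module.projective_lifting_property f LinearMap.id hf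
  refine ⟨s ⟨r, hr⟩, ?_, fun x hx => ?_⟩
  · have := congrArg Subtype.val (LinearMap.congr_fun hs ⟨r, hr⟩)
    simpa [f] using this
  · rw [← smul_eq_mul, ← map_smul]
    have : x • (⟨r, hr⟩ : (Ideal.span {r} : Ideal R)) = 0 := by ext1; simpa using hx
    rw [this, map_zero]

lemma sh_isDomain {R : Type u} [CommRing R]
    (hsh : ∀ I : Ideal R, I.FG → Module.Projective R I) (p : Ideal R) [p.IsPrime] :
    IsDomain (Localization.AtPrime p) := by
  have key : ∀ r x : R, algebraMap R (Localization.AtPrime p) (r * x) = 0 →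
      algebraMap R (Localization.AtPrime p) r = 0 ∨
      algebraMap R (Localization.AtPrime p) x = 0 := by
    intro r x h
    obtain ⟨c, hc, hc'⟩ := sh_idem hsh r
    by_cases hcp : c ∈ p
    · left
      rw [IsLocalization.map_eq_zero_iff p.primeCompl]
      refine ⟨⟨1 - c, fun h1 => ?_⟩, by simp only [sub_mul, one_mul, hc, sub_self]⟩
      have := p.add_mem h1 hcp
      rw [sub_add_cancel] at this
      exact (Ideal.ne_top_iff_one p).1 (Ideal.IsPrime.ne_top ‹_›) this
    · right
      rw [IsLocalization.map_eq_zero_iff p.primeCompl] at h ⊢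
      obtain ⟨u, hu⟩ := h
      refine ⟨u * ⟨c, hcp⟩, ?_⟩
      have := hc' (u * x) (by rw [← hu]; ring)
      rw [← this]; simp only [Submonoid.coe_mul]; ring
  have : NoZeroDivisors (Localization.AtPrime p) := by
    refine ⟨fun {a b} hab => ?_⟩
    obtain ⟨x, s, rfl⟩ := IsLocalization.exists_mk'_eq p.primeCompl a
    obtain ⟨y, t, rfl⟩ := IsLocalization.exists_mk'_eq p.primeCompl b
    rw [← IsLocalization.mk'_mul, IsLocalization.mk'_eq_zero_iff,
      ← IsLocalization.map_eq_zero_iff p.primeCompl (Localization.AtPrime p)] at hab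
    rcases key x y hab with h | h
    · left
      rw [IsLocalization.mk'_eq_zero_iff]
      exact (IsLocalization.map_eq_zero_iff p.primeCompl _ _).1 h
    · right
      rw [IsLocalization.mk'_eq_zero_iff]
      exact (IsLocalization.map_eq_zero_iff p.primeCompl _ _).1 h
  exact NoZeroDivisors.to_isDomain _

lemma sh_pair {R : Type u} [CommRing R] (hsh : ∀ I : Ideal R, I.FG → Module.Projective R I)
    (a b : R) : ∃ α β γ δ : R, α * b = γ * a ∧ β * b = δ * a ∧ a = (α + δ) * a := by
  have hP := hsh (Ideal.span {a, b}) (Submodule.fg_span (Set.toFinite _))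
  have ha : a ∈ Ideal.span {a, b} := Ideal.subset_span (by simp)
  have hb : b ∈ Ideal.span {a, b} := Ideal.subset_span (by simp)
  let f : R × R →ₗ[R] (Ideal.span {a, b} : Ideal R) :=
    (LinearMap.toSpanSingleton R _ ⟨a, ha⟩).coprod (LinearMap.toSpanSingleton R _ ⟨b, hb⟩)
  have hf : Surjective f := by
    rintro ⟨y, hy⟩
    obtain ⟨x, z, rfl⟩ := Ideal.mem_span_pair.1 hy
    exact ⟨(x, z), by ext1; simp [f]⟩
  obtain ⟨s, hs⟩ := Module.projective_lifting_property f LinearMap.id hf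
  have h1 : b • s ⟨a, ha⟩ = a • s ⟨b, hb⟩ := by
    rw [← map_smul, ← map_smul]
    congr 1
    ext1
    simp [mul_comm]
  have h2 := congrArg Subtype.val (LinearMap.congr_fun hs ⟨a, ha⟩)
  have h3 : (s ⟨a, ha⟩).1 * a + (s ⟨a, ha⟩).2 * b = a := by simpa [f] using h2
  have h4 := congrArg Prod.fst h1
  have h5 := congrArg Prod.snd h1
  simp only [Prod.smul_fst, Prod.smul_snd, smul_eq_mul] at h4 h5
  refine ⟨(s ⟨a, ha⟩).1, (s ⟨a, ha⟩).2, (s ⟨b, hb⟩).1, (s ⟨b, hb⟩).2, ?_, ?_, ?_⟩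
  · rw [mul_comm, h4, mul_comm]
  · rw [mul_comm, h5, mul_comm]
  · linear_combination -h3 + h5

lemma sh_valuation {R : Type u} [CommRing R]
    (hsh : ∀ I : Ideal R, I.FG → Module.Projective R I) (p : Ideal R) [p.IsPrime]
    [IsDomain (Localization.AtPrime p)] :
    ValuationRing (Localization.AtPrime p) := by
  set V := Localization.AtPrime p
  have key : ∀ a b : R, algebraMap R V a ∣ algebraMap R V b ∨
      algebraMap R V b ∣ algebraMap R V a := by
    intro a b
    by_cases ha : algebraMap R V a = 0
    · right; rw [ha]; exact dvd_zero _
    obtain ⟨α, β, γ, δ, h1, h2, h3⟩ := sh_pair hsh a b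
    have h4 := congrArg (algebraMap R V) h3
    have h1 := congrArg (algebraMap R V) h1
    have h2 := congrArg (algebraMap R V) h2
    simp only [map_mul, map_add] at h1 h2 h4
    have h5 : algebraMap R V α + algebraMap R V δ = 1 :=
      mul_right_cancel₀ ha (by rw [one_mul]; exact h4.symm)
    rcases IsLocalRing.isUnit_or_isUnit_of_add_one h5 with h | h
    · left
      rw [← h.dvd_mul_left, h1]
      exact dvd_mul_left _ _
    · right
      rw [← h.dvd_mul_left, ← h2]
      exact dvd_mul_left _ _
  rw [ValuationRing.iff_dvd_total]
  refine ⟨fun x y => ?_⟩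
  obtain ⟨a, s, rfl⟩ := IsLocalization.exists_mk'_eq p.primeCompl x
  obtain ⟨b, t, rfl⟩ := IsLocalization.exists_mk'_eq p.primeCompl y
  have assoc : ∀ (a : R) (s : p.primeCompl),
      Associated (IsLocalization.mk' V a s) (algebraMap R V a) := fun a s =>
    ⟨(IsLocalization.map_units V s).unit, by simp⟩
  rw [(assoc a s).dvd_iff_dvd_left, (assoc b t).dvd_iff_dvd_right,
    (assoc b t).dvd_iff_dvd_left, (assoc a s).dvd_iff_dvd_right]
  exact key a b

lemma exists_module_localization {R : Type u} [CommRing R] (p : Ideal R) [p.IsPrime]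
    {A : Type u} [AddCommGroup A] [Module R A]
    (h : ∀ s : R, s ∉ p → Bijective (fun a : A => s • a)) :
    ∃ i : Module (Localization.AtPrime p) A,
      IsScalarTower R (Localization.AtPrime p) A := by
  have hid : IsLocalizedModule p.primeCompl (LinearMap.id : A →ₗ[R] A) :=
    { map_units := fun s => (Module.End.isUnit_iff _).2 (h s s.2)
      surj := fun m => ⟨(m, 1), one_smul _ _⟩
      exists_of_eq := fun h => ⟨1, congr_arg _ h⟩ }
  exact ⟨IsLocalizedModule.module p.primeCompl (LinearMap.id : A →ₗ[R] A),
    IsLocalizedModule.isScalarTower_module p.primeCompl (LinearMap.id : A →ₗ[R] A)⟩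

lemma ProjDimLE1.localize {R : Type u} [CommRing R] (p : Ideal R) [p.IsPrime]
    {A : Type u} [AddCommGroup A] [Module R A] [Module (Localization.AtPrime p) A]
    [IsScalarTower R (Localization.AtPrime p) A] (h : ProjDimLE1 R A) :
    ProjDimLE1 (Localization.AtPrime p) A := by
  obtain ⟨P, g, hP, hg, hK⟩ := h
  have hid : IsLocalizedModule p.primeCompl (LinearMap.id : A →ₗ[R] A) :=
    isLocalizedModule_id p.primeCompl A (Localization.AtPrime p)
  let f := LocalizedModule.mkLinearMap p.primeCompl P
  refine ⟨ModuleCat.of _ (LocalizedModule p.primeCompl P),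
    (IsLocalizedModule.map p.primeCompl f (LinearMap.id : A →ₗ[R] A) g).extendScalarsOfIsLocalization p.primeCompl
      (Localization.AtPrime p), ?_, ?_, ?_⟩
  · exact Module.projective_of_isLocalizedModule p.primeCompl f
  · exact IsLocalizedModule.map_surjective p.primeCompl f (LinearMap.id : A →ₗ[R] A) g hg
  · rw [← LinearMap.localized'_ker_eq_ker_localizedMap]
    exact Module.projective_of_isLocalizedModule p.primeCompl
      (Submodule.toLocalized' (Localization.AtPrime p) p.primeCompl f (LinearMap.ker g))

lemma projective_of_ses {R : Type*} [CommRing R] {K N Q : Type*} [AddCommGroup K] [Module R K]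
    [AddCommGroup N] [Module R N] [AddCommGroup Q] [Module R Q]
    [Module.Projective R K] [Module.Projective R Q] (i : K →ₗ[R] N) (π : N →ₗ[R] Q)
    (hi : Injective i) (hπ : Surjective π) (h0 : ∀ k, π (i k) = 0)
    (hex : ∀ n, π n = 0 → ∃ k, i k = n) : Module.Projective R N := by
  obtain ⟨σ, hσ⟩ := Module.projective_lifting_property π LinearMap.id hπ
  have hσ' : ∀ x, π (σ x) = x := fun x => LinearMap.congr_fun hσ x
  refine Module.Projective.of_equiv (LinearEquiv.ofBijective (i.coprod σ) ⟨?_, ?_⟩)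
  · rw [injective_iff_map_eq_zero]
    rintro ⟨k, x⟩ h
    rw [LinearMap.coprod_apply] at h
    have h1 := congrArg π h
    simp only [map_add, h0, hσ', zero_add, map_zero] at h1
    subst h1
    rw [map_zero, add_zero] at h
    have h2 : k = 0 := hi (h.trans (map_zero i).symm)
    rw [h2]
    rfl
  · intro n
    obtain ⟨k, hk⟩ := hex (n - σ (π n)) (by rw [map_sub, hσ', sub_self])
    exact ⟨(k, π n), by rw [LinearMap.coprod_apply]; simp [hk]⟩

lemma cover_div {R : Type u} [CommRing R] (hsh : ∀ I : Ideal R, I.FG → Module.Projective R I)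
    (p : Ideal R) [p.IsPrime] {A M : Type u} [AddCommGroup A] [Module R A]
    [AddCommGroup M] [Module R M]
    [Module (Localization.AtPrime p) A] [IsScalarTower R (Localization.AtPrime p) A]
    [IsDomain (Localization.AtPrime p)]
    (φ : A →ₗ[R] M) (hA : ProjDimLE1 R A)
    (hpre : ∀ (E : Type u) [AddCommGroup E] [Module R E], ProjDimLE1 R E → ∀ ψ : E →ₗ[R] M,
      ∃ h : E →ₗ[R] A, φ.comp h = ψ)
    (hcov : ∀ e : A →ₗ[R] A, φ.comp e = φ → Bijective e)
    (a : R) (ha : algebraMap R (Localization.AtPrime p) a ≠ 0) (b : A) (hb : φ b = 0) :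
    ∃ b' : A, φ b' = 0 ∧ a • b' = b := by
  let U : Submodule R (A × R) := Submodule.span R {(b, -a)}
  have hU : ∀ x r, (x, r) ∈ U ↔ ∃ s : R, s • b = x ∧ - (s * a) = r := by
    intro x r
    simp only [U, Submodule.mem_span_singleton, Prod.smul_mk, Prod.mk.injEq, smul_eq_mul, mul_neg]
  have hE : ProjDimLE1 R ((A × R) ⧸ U) := by
    obtain ⟨P, g, hP, hg, hK⟩ := hA
    let G : (P × R) →ₗ[R] ((A × R) ⧸ U) := U.mkQ ∘ₗ (g.prodMap LinearMap.id)
    have hG : ∀ x r, G (x, r) = 0 ↔ ∃ s : R, s • b = g x ∧ - (s * a) = r := by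
      intro x r
      rw [← hU]
      exact Submodule.Quotient.mk_eq_zero U
    refine ⟨ModuleCat.of R (P × R), G, inferInstanceAs (Module.Projective R (P × R)), ?_, ?_⟩
    · refine (Submodule.mkQ_surjective U).comp ?_
      rintro ⟨x, r⟩
      obtain ⟨y, rfl⟩ := hg x
      exact ⟨(y, r), rfl⟩
    have hI := hsh (Ideal.span {a}) (Submodule.fg_span_singleton a)
    let π : LinearMap.ker G →ₗ[R] (Ideal.span {a} : Ideal R) :=
      ((LinearMap.snd R P R) ∘ₗ (LinearMap.ker G).subtype).codRestrict _ (by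
        rintro ⟨⟨x, r⟩, hx⟩
        obtain ⟨s, h1, h2⟩ := (hG x r).1 hx
        exact Ideal.mem_span_singleton'.2 ⟨-s, (neg_mul s a).trans h2⟩)
    let i : LinearMap.ker g →ₗ[R] LinearMap.ker G :=
      ((LinearMap.inl R P R) ∘ₗ (LinearMap.ker g).subtype).codRestrict _ (by
        rintro ⟨x, hx⟩
        refine (hG x 0).2 ⟨0, ?_, ?_⟩
        · rw [zero_smul]; exact hx.symm
        · simp)
    refine projective_of_ses i π ?_ ?_ ?_ ?_
    · intro x y h
      have := congrArg (fun z : LinearMap.ker G => z.1.1) h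
      exact Subtype.ext this
    · rintro ⟨y, hy⟩
      obtain ⟨s, rfl⟩ := Ideal.mem_span_singleton'.1 hy
      obtain ⟨x, hx⟩ := hg ((-s) • b)
      exact ⟨⟨(x, s * a), (hG _ _).2 ⟨-s, hx.symm, by simp⟩⟩, rfl⟩
    · intro k; rfl
    · rintro ⟨⟨x, r⟩, hx⟩ h
      have hr : r = 0 := congrArg Subtype.val h
      subst hr
      obtain ⟨s, h1, h2⟩ := (hG x 0).1 hx
      have h3 : algebraMap R (Localization.AtPrime p) s = 0 := by
        have := congrArg (algebraMap R (Localization.AtPrime p)) (neg_eq_zero.1 h2)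
        rw [map_mul, map_zero] at this
        exact (mul_eq_zero.1 this).resolve_right ha
      have h4 : g x = 0 := by
        rw [← h1, ← algebraMap_smul (Localization.AtPrime p) s b, h3, zero_smul]
      exact ⟨⟨x, h4⟩, rfl⟩
  let ψ : ((A × R) ⧸ U) →ₗ[R] M := U.liftQ (φ ∘ₗ LinearMap.fst R A R) (by
    rintro ⟨x, r⟩ hx
    obtain ⟨s, h1, h2⟩ := (hU x r).1 hx
    simp [← h1, hb])
  obtain ⟨h, hh⟩ := hpre _ hE ψ
  have hh' : ∀ x r, φ (h (U.mkQ (x, r))) = φ x := fun x r =>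
    LinearMap.congr_fun hh (U.mkQ (x, r))
  let e : A →ₗ[R] A := h ∘ₗ U.mkQ ∘ₗ LinearMap.inl R A R
  have heφ : ∀ x, φ (e x) = φ x := fun x => hh' x 0
  obtain ⟨einj, esurj⟩ := hcov e (LinearMap.ext heφ)
  obtain ⟨w, hw⟩ := esurj (h (U.mkQ (0, 1)))
  refine ⟨w, ?_, einj ?_⟩
  · rw [← heφ, hw, hh', map_zero]
  · rw [map_smul, hw, ← map_smul, ← map_smul]
    change h _ = h (U.mkQ (b, 0))
    congr 1
    refine ((Submodule.Quotient.eq U).2 ?_)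
    refine (hU _ _).2 ⟨-1, by simp, by simp⟩

lemma swindle {V : Type u} [CommRing V] {Q : Type u} [AddCommGroup Q] [Module V Q]
    [hQ : Module.Projective V Q] :
    ∃ Z : Type u, Nonempty ((Q × (Z →₀ V)) ≃ₗ[V] (Z →₀ V)) := by
  obtain ⟨s, hs⟩ := Module.projective_def'.1 hQ
  have hs' : ∀ x, Finsupp.linearCombination V id (s x) = x := fun x => LinearMap.congr_fun hs x
  generalize hr : Finsupp.linearCombination V (id : Q → Q) = r at hs'
  let L := Q →₀ V
  let ρ : L →ₗ[V] L := s ∘ₗ r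
  have hsx : ∀ x, r (s x) = x := hs'
  let F : Q × (ℕ →₀ L) →ₗ[V] (ℕ →₀ L) :=
    ((Finsupp.lsingle 0) ∘ₗ s).coprod
      ((Finsupp.lmapDomain L V Nat.succ) ∘ₗ Finsupp.mapRange.linearMap ρ +
        Finsupp.mapRange.linearMap (LinearMap.id - ρ))
  let G : (ℕ →₀ L) →ₗ[V] Q × (ℕ →₀ L) :=
    (r ∘ₗ Finsupp.lapply 0).prod
      ((Finsupp.lcomapDomain Nat.succ Nat.succ_injective) ∘ₗ Finsupp.mapRange.linearMap ρ +
        Finsupp.mapRange.linearMap (LinearMap.id - ρ))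
  have hF0 : ∀ x t, F (x, t) 0 = s x + (t 0 - s (r (t 0))) := by
    intro x t
    have h0 : (Finsupp.mapDomain Nat.succ (Finsupp.mapRange.linearMap (R := V) ρ t)) 0 = 0 :=
      Finsupp.mapDomain_of_notMem_range _ _ (by simp)
    simpa [F, ρ] using h0
  have hF1 : ∀ x t n, F (x, t) (n + 1) = s (r (t n)) + (t (n+1) - s (r (t (n+1)))) := by
    intro x t n
    have h0 : (Finsupp.mapDomain Nat.succ (Finsupp.mapRange.linearMap (R := V) ρ t)) (n+1) = ρ (t n) := by
      have := Finsupp.mapDomain_apply Nat.succ_injective (Finsupp.mapRange.linearMap (R := V) ρ t) n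
      exact this
    simpa [F, ρ] using h0
  have hG1 : ∀ u, (G u).1 = r (u 0) := fun u => rfl
  have hG2 : ∀ u n, (G u).2 n = s (r (u (n+1))) + (u n - s (r (u n))) := by
    intro u n
    simp [G, ρ, Finsupp.lcomapDomain]
  let e : (Q × (ℕ →₀ L)) ≃ₗ[V] (ℕ →₀ L) := LinearEquiv.ofLinearMap F G (by
    refine LinearMap.ext fun u => Finsupp.ext fun n => ?_
    change F ((G u).1, (G u).2) n = u n
    cases n with
    | zero =>
      rw [hF0, hG1, hG2]
      simp only [map_add, map_sub, hsx]
      abel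
    | succ n =>
      rw [hF1, hG2, hG2]
      simp only [map_add, map_sub, hsx]
      abel) (by
    refine LinearMap.ext fun u => ?_
    obtain ⟨x, t⟩ := u
    refine Prod.ext ?_ (Finsupp.ext fun n => ?_)
    · change (G (F (x, t))).1 = x
      rw [hG1, hF0]
      simp only [map_add, map_sub, hsx]
      abel
    · change (G (F (x, t))).2 n = t n
      rw [hG2]
      cases n with
      | zero =>
        rw [hF0, hF1]
        simp only [map_add, map_sub, hsx]
        abel
      | succ n =>
        rw [hF1, hF1]
        simp only [map_add, map_sub, hsx]
        abel)
  exact ⟨ℕ × Q, ⟨((LinearEquiv.refl V Q).prodCongr (Finsupp.curryLinearEquiv V)).trans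
    (e.trans (Finsupp.curryLinearEquiv V).symm)⟩⟩

lemma exists_free_res {V : Type u} [CommRing V] {A : Type u} [AddCommGroup A] [Module V A]
    (h : ProjDimLE1 V A) : ∃ (X Y : Type u) (φ : (Y →₀ V) →ₗ[V] (X →₀ V))
      (q : (X →₀ V) →ₗ[V] A), Injective φ ∧ Surjective q ∧
      LinearMap.range φ = LinearMap.ker q := by
  obtain ⟨P, g, hP, hg, hK⟩ := h
  obtain ⟨Z1, ⟨e1⟩⟩ := swindle (V := V) (Q := P)
  obtain ⟨Z2, ⟨e2⟩⟩ := swindle (V := V) (Q := LinearMap.ker g × (Z1 →₀ V))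
  let E : ((Z1 ⊕ Z2) →₀ V) ≃ₗ[V] (P × (Z1 →₀ V)) × (Z2 →₀ V) :=
    (Finsupp.sumFinsuppLEquivProdFinsupp V).trans
      (e1.symm.prodCongr (LinearEquiv.refl V (Z2 →₀ V)))
  let j : (LinearMap.ker g × (Z1 →₀ V)) × (Z2 →₀ V) →ₗ[V] (P × (Z1 →₀ V)) × (Z2 →₀ V) :=
    ((LinearMap.ker g).subtype.prodMap LinearMap.id).prodMap LinearMap.id
  have hj : Injective j := by
    rintro ⟨⟨x, y⟩, z⟩ ⟨⟨x', y'⟩, z'⟩ h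
    simp only [j, LinearMap.prodMap_apply, Prod.mk.injEq, LinearMap.id_apply] at h
    obtain ⟨⟨h1, rfl⟩, rfl⟩ := h
    rw [Subtype.ext h1]
  let q0 : (P × (Z1 →₀ V)) × (Z2 →₀ V) →ₗ[V] A := g ∘ₗ LinearMap.fst V _ _ ∘ₗ LinearMap.fst V _ _
  refine ⟨Z1 ⊕ Z2, Z2, E.symm.toLinearMap ∘ₗ j ∘ₗ e2.symm.toLinearMap, q0 ∘ₗ E.toLinearMap, ?_, ?_, ?_⟩
  · exact E.symm.injective.comp (hj.comp e2.symm.injective)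
  · refine Surjective.comp (g := q0) ?_ E.surjective
    intro a
    obtain ⟨x, rfl⟩ := hg a
    exact ⟨((x, 0), 0), rfl⟩
  · ext x
    constructor
    · rintro ⟨y, rfl⟩
      have h1 : ∀ z, q0 (j z) = 0 := fun z => z.1.1.2
      have : E (E.symm (j (e2.symm y))) = j (e2.symm y) := E.apply_symm_apply _
      change q0 (E (E.symm (j (e2.symm y)))) = 0
      rw [this, h1]
    · intro hx
      have hx' : g (E x).1.1 = 0 := hx
      refine ⟨e2 ((⟨(E x).1.1, hx'⟩, (E x).1.2), (E x).2), ?_⟩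
      change E.symm (j (e2.symm (e2 _))) = x
      rw [e2.symm_apply_apply, LinearEquiv.symm_apply_eq]
      rfl

lemma projDimLE1_of_equiv {R : Type u} [CommRing R] {A M : Type u} [AddCommGroup A] [Module R A]
    [AddCommGroup M] [Module R M] (e : A ≃ₗ[R] M) (h : ProjDimLE1 R A) : ProjDimLE1 R M := by
  obtain ⟨P, g, hP, hg, hK⟩ := h
  refine ⟨P, e.toLinearMap ∘ₗ g, hP, e.surjective.comp hg, ?_⟩
  rw [LinearEquiv.ker_comp]
  exact hK

lemma projDimLE1_of_projective {R : Type u} [CommRing R] {P : Type u} [AddCommGroup P]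
    [Module R P] [Module.Projective R P] : ProjDimLE1 R P := by
  refine ⟨ModuleCat.of R P, LinearMap.id, ‹_›, surjective_id, ?_⟩
  rw [LinearMap.ker_id]
  infer_instance

lemma cover_inj {R : Type u} [CommRing R]
    (hsh : ∀ I : Ideal R, I.FG → Module.Projective R I)
    (p : Ideal R) [p.IsPrime] {A M : Type u} [AddCommGroup A] [Module R A]
    [AddCommGroup M] [Module R M]
    [Module (Localization.AtPrime p) A] [IsScalarTower R (Localization.AtPrime p) A]
    [Module (Localization.AtPrime p) M] [IsScalarTower R (Localization.AtPrime p) M]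
    (φ : A →ₗ[R] M) (hA : ProjDimLE1 R A)
    (hpre : ∀ (E : Type u) [AddCommGroup E] [Module R E], ProjDimLE1 R E → ∀ ψ : E →ₗ[R] M,
      ∃ h : E →ₗ[R] A, φ.comp h = ψ)
    (hcov : ∀ e : A →ₗ[R] A, φ.comp e = φ → Bijective e) : Injective φ := by
  have hdom : IsDomain (Localization.AtPrime p) := sh_isDomain hsh p
  have hval : ValuationRing (Localization.AtPrime p) := sh_valuation hsh p
  obtain ⟨X, Y, f, q, hf, hq, hex⟩ := exists_free_res (hA.localize p)
  let φ' : A →ₗ[Localization.AtPrime p] M :=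
    φ.extendScalarsOfIsLocalization p.primeCompl (Localization.AtPrime p)
  have hφ' : ∀ x, φ' x = φ x := fun x => rfl
  rw [injective_iff_map_eq_zero]
  intro x hx
  obtain ⟨θ, hθ, hθx⟩ := local_split hf q hq hex (LinearMap.ker φ') (by
    intro t ht b hb
    obtain ⟨a, s, rfl⟩ := IsLocalization.exists_mk'_eq p.primeCompl t
    have ha : algebraMap R (Localization.AtPrime p) a ≠ 0 := by
      intro h
      apply ht
      rw [IsLocalization.mk'_eq_zero_iff]
      exact (IsLocalization.map_eq_zero_iff p.primeCompl _ _).1 h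
    obtain ⟨b', hb', hab⟩ := cover_div hsh p φ hA hpre hcov a ha b hb
    refine ⟨(s : R) • b', ?_, ?_⟩
    · change φ _ = 0
      rw [map_smul, hb', smul_zero]
    · rw [← algebraMap_smul (Localization.AtPrime p) (s : R) b', smul_smul,
        IsLocalization.mk'_spec, algebraMap_smul, hab]) x hx
  have h1 : ∀ y, φ (θ y) = 0 := hθ
  have hb := hcov (LinearMap.id - θ.restrictScalars R) (by
    ext y
    simp [h1])
  apply hb.1
  simp [hθx]

lemma p1_main {R : Type u} [CommRing R]
    (hsh : ∀ I : Ideal R, I.FG → Module.Projective R I)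
    (hcov : IsCoveringClass R (P1Class R)) (p : Ideal R) [p.IsPrime]
    (M : Type u) [AddCommGroup M] [Module R M] [Module (Localization.AtPrime p) M]
    [IsScalarTower R (Localization.AtPrime p) M] : ProjDimLE1 R M := by
  obtain ⟨A, φ, hA, hpre, hc⟩ := hcov (ModuleCat.of R M)
  have hA : ProjDimLE1 R A := hA
  have hc : ∀ e : A →ₗ[R] A, φ.comp e = φ → Bijective e := hc
  have hpre' : ∀ (E : Type u) [AddCommGroup E] [Module R E], ProjDimLE1 R E →
      ∀ ψ : E →ₗ[R] M, ∃ h : E →ₗ[R] A, φ.comp h = ψ :=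
    fun E _ _ hE ψ => hpre (ModuleCat.of R E) hE ψ
  have hsurj : Surjective φ := by
    intro m
    obtain ⟨h, hh⟩ := hpre' (ULift.{u} R) projDimLE1_of_projective
      ((LinearMap.toSpanSingleton R M m) ∘ₗ ULift.moduleEquiv.toLinearMap)
    refine ⟨h ⟨1⟩, ?_⟩
    have := LinearMap.congr_fun hh ⟨1⟩
    simpa using this
  have hs : ∀ s : R, s ∉ p → Bijective (fun a : A => s • a) := by
    intro s hs
    obtain ⟨v, hv⟩ := (IsLocalization.map_units (Localization.AtPrime p)
      (⟨s, hs⟩ : p.primeCompl)).exists_right_inv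
    let σ : M →ₗ[R] M := LinearMap.restrictScalars R (v • (LinearMap.id : M →ₗ[Localization.AtPrime p] M))
    have hσ : ∀ m, s • σ m = m := by
      intro m
      change s • v • m = m
      rw [← algebraMap_smul (Localization.AtPrime p) s, smul_smul, hv, one_smul]
    obtain ⟨e, he⟩ := hpre' A hA (σ ∘ₗ φ)
    have h1 := hc (s • e) (by
      ext a
      have h2 : φ (e a) = σ (φ a) := LinearMap.congr_fun he a
      rw [LinearMap.comp_apply, LinearMap.smul_apply, map_smul, h2]
      exact hσ _)
    constructor
    · intro a b hab
      apply h1.1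
      simp only [LinearMap.smul_apply, ← map_smul]
      exact congrArg e hab
    · intro a
      obtain ⟨b, hb⟩ := h1.2 a
      exact ⟨e b, hb⟩
  obtain ⟨i, hi⟩ := exists_module_localization p hs
  have hinj : Injective φ := cover_inj hsh p (M := M) φ hA hpre' hc
  exact projDimLE1_of_equiv (LinearEquiv.ofBijective φ ⟨hinj, hsurj⟩) hA

lemma sh_pid {R : Type u} [CommRing R]
    (hsh : ∀ I : Ideal R, I.FG → Module.Projective R I)
    (hcov : IsCoveringClass R (P1Class R)) (p : Ideal R) [p.IsPrime] :
    IsPrincipalIdealRing (Localization.AtPrime p) := by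
  have hdom : IsDomain (Localization.AtPrime p) := sh_isDomain hsh p
  have hval : ValuationRing (Localization.AtPrime p) := sh_valuation hsh p
  refine ⟨fun I => ?_⟩
  have h := p1_main hsh hcov p (Localization.AtPrime p ⧸ I)
  obtain ⟨X, Y, f, q, hf, hq, hex⟩ := exists_free_res (h.localize p)
  obtain ⟨t, ht⟩ := ann_principal hf q hq hex (Ideal.Quotient.mk I 1)
  refine ⟨t, ?_⟩
  ext v
  change v ∈ I ↔ v ∈ Ideal.span {t}
  rw [Ideal.mem_span_singleton, ← ht v]
  have : v • (Ideal.Quotient.mk I 1) = Ideal.Quotient.mk I v := by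
    change Ideal.Quotient.mk I (v • 1) = _
    rw [smul_eq_mul, mul_one]
  rw [this, Ideal.Quotient.eq_zero_iff_mem]

lemma sh_maximal {R : Type u} [CommRing R]
    (m : Ideal R) (h : ProjDimLE1 R (R ⧸ m)) : Module.Projective R m := by
  obtain ⟨P, g, hP, hg, hK⟩ := h
  obtain ⟨h, hh⟩ := Module.projective_lifting_property g (Submodule.mkQ m) hg
  have hh' : ∀ x, g (h x) = Submodule.mkQ m x := fun x => LinearMap.congr_fun hh x
  have hm : ∀ x, Submodule.mkQ m x = 0 ↔ x ∈ m := fun x => Submodule.Quotient.mk_eq_zero m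
  let F : (LinearMap.ker g × R) →ₗ[R] P := (LinearMap.ker g).subtype.coprod h
  have hF : Surjective F := by
    intro y
    obtain ⟨x, hx⟩ := Submodule.mkQ_surjective m (g y)
    refine ⟨(⟨y - h x, ?_⟩, x), ?_⟩
    · rw [LinearMap.mem_ker, map_sub, hh', hx, sub_self]
    · simp [F]
  obtain ⟨σ, hσ⟩ := Module.projective_lifting_property F LinearMap.id hF
  have hσ' : ∀ x, F (σ x) = x := fun x => LinearMap.congr_fun hσ x
  have hFz : ∀ z : LinearMap.ker g × R, F z = z.1 + h z.2 := fun z => by simp [F]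
  let i : m →ₗ[R] (LinearMap.ker g × R) :=
    LinearMap.prod (LinearMap.codRestrict _ (-(h ∘ₗ m.subtype)) (by
      intro x
      have := (hm x).2 x.2
      simp [hh', this])) m.subtype
  have hi1 : ∀ x, ((i x).1 : P) = - h x := fun x => rfl
  have hi2 : ∀ x, (i x).2 = x := fun x => rfl
  let r : (LinearMap.ker g × R) →ₗ[R] m :=
    LinearMap.codRestrict m (LinearMap.snd R _ _ ∘ₗ (LinearMap.id - σ ∘ₗ F)) (by
      intro z
      have h1 : F (z - σ (F z)) = 0 := by rw [map_sub, hσ', sub_self]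
      rw [hFz] at h1
      change (z - σ (F z)).2 ∈ m
      rw [← hm, ← hh']
      have h2 := congrArg g h1
      rw [map_add, map_zero] at h2
      have h3 : g ((z - σ (F z)).1 : P) = 0 := (z - σ (F z)).1.2
      rw [h3, zero_add] at h2
      exact h2)
  refine Module.Projective.of_split i r ?_
  ext x
  have : F (i x) = 0 := by rw [hFz, hi1, hi2]; simp
  change (i x - σ (F (i x))).2 = x
  rw [this, map_zero, sub_zero, hi2]

/-- **Lemma 6.5.** Let `R` be a commutative semihereditary ring such that `𝒫₁(R)` is
covering. Then for each prime `𝔭` the localisation `R_𝔭` is a discrete valuation domain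
or a field (i.e. a local principal ideal domain); moreover every `R_𝔭`-module has
projective dimension at most 1 over `R`; consequently every maximal ideal of `R` is
projective. -/
theorem sh_covering_localizations_are_dvr (R : Type u) [CommRing R]
    (hsh : ∀ I : Ideal R, I.FG → Module.Projective R I)
    (hcov : IsCoveringClass R (P1Class R)) :
    (∀ (p : Ideal R) [p.IsPrime], IsDomain (Localization.AtPrime p) ∧
      IsPrincipalIdealRing (Localization.AtPrime p) ∧
      IsLocalRing (Localization.AtPrime p)) ∧
    (∀ (p : Ideal R) [p.IsPrime],
      ∀ (M : Type u) [AddCommGroup M] [Module R M] [Module (Localization.AtPrime p) M],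
        IsScalarTower R (Localization.AtPrime p) M → ProjDimLE1 R M) ∧
    (∀ m : Ideal R, m.IsMaximal → Module.Projective R m) := by
  refine ⟨fun p _ => ⟨sh_isDomain hsh p, sh_pid hsh hcov p, inferInstance⟩,
    fun p _ M _ _ _ _ => p1_main hsh hcov p M, fun m hm => ?_⟩
  apply sh_maximal
  have hs : ∀ s : R, s ∉ m → Bijective (fun a : R ⧸ m => s • a) := by
    intro s hs
    obtain ⟨y, z, hz, h1⟩ := hm.exists_inv hs
    have h1' : Ideal.Quotient.mk m y * Ideal.Quotient.mk m s = 1 := by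
      rw [← map_mul, ← map_one (Ideal.Quotient.mk m), ← h1, map_add,
        Ideal.Quotient.eq_zero_iff_mem.2 hz, add_zero]
    have h2 : ∀ a : R ⧸ m, s • a = Ideal.Quotient.mk m s * a := fun a => Algebra.smul_def s a
    constructor
    · intro a b hab
      simp only [h2] at hab
      calc a = Ideal.Quotient.mk m y * (Ideal.Quotient.mk m s * a) := by
              rw [← mul_assoc, h1', one_mul]
        _ = b := by rw [hab, ← mul_assoc, h1', one_mul]
    · intro a
      refine ⟨Ideal.Quotient.mk m y * a, ?_⟩
      simp only [h2]
      rw [← mul_assoc, mul_comm (Ideal.Quotient.mk m s), h1', one_mul]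
  have := hm.isPrime
  obtain ⟨i, hi⟩ := exists_module_localization m hs
  exact p1_main hsh hcov m (R ⧸ m)
end

section
/- Let R be a commutative semihereditary ring such that the class 𝒫₁(R) is covering. Then R is hereditary (every ideal of R is projective); consequently 𝒫₁(R) = Mod-R and 𝒫₁(R) is closed under direct limits. -/
universe u

open MulOpposite Function

/-- `M` is a direct limit (directed colimit) of a direct system of modules from the
class `C`. -/
def IsDirectLimitOf (A : Type u) [Ring A] (C : Set (ModuleCat.{u} A)) (M : Type u)
    [AddCommGroup M] [Module A M] : Prop :=
  ∃ (ι : Type u) (le : ι → ι → Prop) (htrans : ∀ i j k, le i j → le j k → le i k),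
    Nonempty ι ∧
    (∀ i, le i i) ∧
    (∀ i j, ∃ k, le i k ∧ le j k) ∧
    ∃ (G : ι → ModuleCat.{u} A) (f : ∀ i j, le i j → ((G i : Type u) →ₗ[A] (G j : Type u)))
      (g : ∀ i, (G i : Type u) →ₗ[A] M),
      (∀ i, G i ∈ C) ∧
      (∀ i (h : le i i), f i i h = LinearMap.id) ∧
      (∀ i j k (hij : le i j) (hjk : le j k),
        (f j k hjk).comp (f i j hij) = f i k (htrans i j k hij hjk)) ∧
      (∀ i j (hij : le i j), (g j).comp (f i j hij) = g i) ∧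
      (∀ m : M, ∃ i x, g i x = m) ∧
      (∀ i x, g i x = 0 → ∃ j hij, f i j hij x = 0)

/-- Generalised Schanuel lemma: kernels of projective presentations of retracts. -/
theorem aux_schanuel {R : Type u} [CommRing R] {M P : Type u} [AddCommGroup M] [Module R M]
    [AddCommGroup P] [Module R P] (hP : ProjDimLE1 R P)
    (i : M →ₗ[R] P) (r : P →ₗ[R] M) (hri : ∀ m, r (i m) = m)
    {E : Type u} [AddCommGroup E] [Module R E] [Module.Projective R E]
    (q : E →ₗ[R] M) (hq : Function.Surjective q) : Module.Projective R (LinearMap.ker q) := by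
  obtain ⟨F, g, hF, hg, hH⟩ := hP
  obtain ⟨a, ha⟩ := Module.projective_lifting_property g (i.comp q) hg
  obtain ⟨b, hb⟩ := Module.projective_lifting_property q (r.comp g) hq
  have ha' : ∀ x, g (a x) = i (q x) := fun x => LinearMap.congr_fun ha x
  have hb' : ∀ x, q (b x) = r (g x) := fun x => LinearMap.congr_fun hb x
  let s1 : LinearMap.ker q →ₗ[R] LinearMap.ker g :=
    (a.comp (LinearMap.ker q).subtype).codRestrict _ (fun x => by
      have := x.2
      rw [LinearMap.mem_ker] at this
      simp [LinearMap.mem_ker, ha', this])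
  let t1 : (LinearMap.ker g) →ₗ[R] LinearMap.ker q :=
    (b.comp (LinearMap.ker g).subtype).codRestrict _ (fun x => by
      have := x.2
      rw [LinearMap.mem_ker] at this
      simp [LinearMap.mem_ker, hb', this])
  let t2 : E →ₗ[R] LinearMap.ker q :=
    (LinearMap.id - b.comp a).codRestrict _ (fun x => by
      simp [LinearMap.mem_ker, ha', hb', hri])
  refine Module.Projective.of_split (M := LinearMap.ker g × E)
    (s1.prod (LinearMap.ker q).subtype) (t1.coprod t2) ?_
  ext x
  change b (a (x : E)) + ((x : E) - b (a (x : E))) = (x : E)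
  abel

theorem aux_p1_of_proj {R : Type u} [CommRing R] {M E : Type u} [AddCommGroup M] [Module R M]
    [AddCommGroup E] [Module R E] [hE : Module.Projective R E]
    (q : E →ₗ[R] M) (hq : Function.Surjective q) (hk : Module.Projective R (LinearMap.ker q)) :
    ProjDimLE1 R M :=
  ⟨ModuleCat.of R E, q, hE, hq, hk⟩

theorem aux_p1_quot {R : Type u} [CommRing R] (I : Ideal R) (hI : Module.Projective R I) :
    ProjDimLE1 R (R ⧸ I) := by
  refine aux_p1_of_proj (E := R) (Submodule.mkQ I) (Submodule.mkQ_surjective I) ?_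
  rw [Submodule.ker_mkQ]
  exact hI

theorem aux_fg_proj {R : Type u} [CommRing R]
    (hsh : ∀ I : Ideal R, I.FG → Module.Projective R I) (n : ℕ) :
    ∀ (N : Type u) [AddCommGroup N] [Module R N] [Module.Finite R N] (f : Fin n → N →ₗ[R] R),
      (∀ x, (∀ k, f k x = 0) → x = 0) → Module.Projective R N := by
  induction n with
  | zero =>
    intro N _ _ _ f hf
    have : Subsingleton N := ⟨fun x y => by
      rw [hf x (fun k => k.elim0), hf y (fun k => k.elim0)]⟩
    infer_instance
  | succ n ih =>
    intro N _ _ _ f hf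
    have hI : Module.Projective R (LinearMap.range (f 0)) := by
      refine hsh _ ?_
      rw [LinearMap.range_eq_map]
      exact Submodule.FG.map _ Module.Finite.fg_top
    obtain ⟨s, hs⟩ := LinearMap.exists_rightInverse_of_surjective (f 0).rangeRestrict
      (LinearMap.range_rangeRestrict _)
    have hs' : ∀ y, (f 0) (s y) = y := fun y => by
      have := LinearMap.congr_fun hs y
      exact congrArg Subtype.val this
    let t : N →ₗ[R] LinearMap.ker (f 0) :=
      (LinearMap.id - s.comp (f 0).rangeRestrict).codRestrict _ (fun x => by
        simp [LinearMap.mem_ker, hs'])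
    have ht : Function.Surjective t := by
      intro x
      refine ⟨x, ?_⟩
      have h0 : (f 0).rangeRestrict (x : N) = 0 := by
        ext
        simpa using x.2
      ext
      simp [t, h0]
    have : Module.Finite R (LinearMap.ker (f 0)) := Module.Finite.of_surjective t ht
    have hk : Module.Projective R (LinearMap.ker (f 0)) := by
      refine ih _ (fun k => (f k.succ).comp (LinearMap.ker (f 0)).subtype) ?_
      intro x hx
      ext
      refine hf x ?_
      intro k
      refine Fin.cases ?_ ?_ k
      · exact x.2
      · intro k; exact hx k
    refine Module.Projective.of_split (M := LinearMap.ker (f 0) × LinearMap.range (f 0))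
      (t.prod (f 0).rangeRestrict) ((LinearMap.ker (f 0)).subtype.coprod s) ?_
    ext x
    simp [t]

theorem aux_fg_sub_proj {R : Type u} [CommRing R]
    (hsh : ∀ I : Ideal R, I.FG → Module.Projective R I)
    {F : Type u} [AddCommGroup F] [Module R F] [hF : Module.Projective R F]
    (N : Submodule R F) (hN : N.FG) : Module.Projective R N := by
  classical
  obtain ⟨s, hs⟩ := Module.projective_def'.1 hF
  have hs' : ∀ y, Finsupp.linearCombination R (id : F → F) (s y) = y :=
    fun y => LinearMap.congr_fun hs y
  have : Module.Finite R N := Module.Finite.iff_fg.2 hN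
  obtain ⟨T, hT⟩ := hN
  let A : Finset F := T.biUnion (fun y => (s y).support)
  have hA : N ≤ (Finsupp.supported R R (A : Set F)).comap s := by
    rw [← hT, Submodule.span_le]
    intro y hy
    simp only [SetLike.mem_coe, Submodule.mem_comap, Finsupp.mem_supported]
    intro z hz
    simp only [A, Finset.coe_biUnion, Set.mem_iUnion]
    exact ⟨y, hy, hz⟩
  refine aux_fg_proj hsh A.card N
    (fun k => (Finsupp.lapply (A.equivFin.symm k : F)).comp (s.comp N.subtype)) ?_
  intro x hx
  have h0 : s (x : F) = 0 := by
    ext z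
    by_cases hz : z ∈ A
    · have := hx (A.equivFin ⟨z, hz⟩)
      simpa using this
    · have h1 := hA x.2
      simp only [Submodule.mem_comap, Finsupp.mem_supported] at h1
      by_contra h2
      exact hz (h1 (Finsupp.mem_support_iff.2 h2))
  ext
  rw [← hs' x, h0]; simp

theorem aux_quot_tors {R : Type u} [CommRing R]
    (hsh : ∀ I : Ideal R, I.FG → Module.Projective R I)
    {P : Type u} [AddCommGroup P] [Module R P] (hP : ProjDimLE1 R P)
    (x : P) (a : R) (ha : ∀ y : R, a * y = 0 → y = 0) (hax : a • x = 0) :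
    ProjDimLE1 R (P ⧸ Submodule.span R {x}) := by
  classical
  obtain ⟨F, g, hF, hg, hH⟩ := hP
  obtain ⟨w, rfl⟩ := hg x
  set H := LinearMap.ker g with hHdef
  obtain ⟨s, hs⟩ := Module.projective_def'.1 hH
  let lc : (H →₀ R) →ₗ[R] H := Finsupp.linearCombination R (id : H → H)
  have hs' : ∀ y, lc (s y) = y := fun y => LinearMap.congr_fun hs y
  let q : F →ₗ[R] (P ⧸ Submodule.span R {g w}) := (Submodule.mkQ _).comp g
  have hq : Function.Surjective q := (Submodule.mkQ_surjective _).comp hg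
  refine aux_p1_of_proj (E := F) q hq ?_
  let t : (H × R) →ₗ[R] F := H.subtype.coprod (LinearMap.toSpanSingleton R F w)
  have ht : LinearMap.range t = LinearMap.ker q := by
    ext z
    simp only [LinearMap.mem_range, LinearMap.mem_ker, q, LinearMap.comp_apply,
      Submodule.mkQ_apply, Submodule.Quotient.mk_eq_zero, Submodule.mem_span_singleton]
    constructor
    · rintro ⟨⟨h, r⟩, rfl⟩
      refine ⟨r, ?_⟩
      have : g (h : F) = 0 := LinearMap.mem_ker.1 h.2
      simp [t, this]
    · rintro ⟨r, hr⟩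
      refine ⟨(⟨z - r • w, ?_⟩, r), ?_⟩
      · rw [hHdef, LinearMap.mem_ker]; simp [hr]
      · simp [t]
  rw [← ht]
  have hw : a • w ∈ H := by rw [hHdef, LinearMap.mem_ker]; simpa using hax
  let A : Finset H := (s ⟨a • w, hw⟩).support
  -- projection away from A
  let ρ : (H →₀ R) →ₗ[R] (H →₀ R) :=
    (Finsupp.supported R R ((A : Set H)ᶜ)).subtype.comp (Finsupp.restrictDom R R ((A : Set H)ᶜ))
  have hρ1 : ∀ v z, z ∈ A → ρ v z = 0 := by
    intro v z hz
    simp [ρ, Finsupp.restrictDom_apply, Finsupp.filter_apply, hz]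
  have hρ2 : ∀ v z, z ∉ A → ρ v z = v z := by
    intro v z hz
    simp [ρ, Finsupp.restrictDom_apply, Finsupp.filter_apply, hz]
  have hker : LinearMap.ker t ≤ LinearMap.ker ((ρ.comp s).comp (LinearMap.fst R H R)) := by
    rintro ⟨h, r⟩ hhr
    rw [LinearMap.mem_ker] at hhr ⊢
    have e1 : (h : F) + r • w = 0 := by simpa [t] using hhr
    have e2 : a • h = -(r • (⟨a • w, hw⟩ : H)) := by
      ext
      have : (h : F) = - (r • w) := eq_neg_of_add_eq_zero_left e1
      simp [this, smul_comm a r w]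
    have e3 : a • s h = -(r • s ⟨a • w, hw⟩) := by
      rw [← map_smul, e2, map_neg, map_smul]
    ext z
    simp only [LinearMap.comp_apply, LinearMap.fst_apply, Finsupp.coe_zero, Pi.zero_apply]
    by_cases hz : z ∈ A
    · exact hρ1 _ _ hz
    · rw [hρ2 _ _ hz]
      apply ha
      have := DFunLike.congr_fun e3 z
      have hz' : s ⟨a • w, hw⟩ z = 0 := Finsupp.notMem_support_iff.1 hz
      simpa [hz'] using this
  let σ : LinearMap.range t →ₗ[R] (H →₀ R) :=
    ((LinearMap.ker t).liftQ _ hker).comp t.quotKerEquivRange.symm.toLinearMap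
  have hσ : ∀ (h : H) (r : R) (hm : (h : F) + r • w ∈ LinearMap.range t),
      σ ⟨(h : F) + r • w, hm⟩ = ρ (s h) := by
    intro h r hm
    have : t.quotKerEquivRange.symm ⟨(h : F) + r • w, hm⟩ = Submodule.Quotient.mk (h, r) := by
      rw [LinearEquiv.symm_apply_eq]
      ext
      simp [t]
    simp only [σ, LinearMap.comp_apply, LinearEquiv.coe_coe, this]
    simp
  -- finitely generated part
  let L0 : Submodule R F :=
    Submodule.span R ((A.image (fun z : H => (z : F)) : Finset F) : Set F) ⊔ Submodule.span R {w}
  have hL0 : L0.FG := Submodule.FG.sup ⟨_, rfl⟩ (Submodule.fg_span_singleton w)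
  have hL0p : Module.Projective R L0 := aux_fg_sub_proj hsh L0 hL0
  have hH_le : ∀ h : H, (h : F) ∈ LinearMap.range t := fun h => ⟨(h, 0), by simp [t]⟩
  have hL0_le : L0 ≤ LinearMap.range t := by
    refine sup_le ?_ ?_
    · rw [Submodule.span_le]
      intro z hz
      simp only [Finset.coe_image, Set.mem_image] at hz
      obtain ⟨y, _, rfl⟩ := hz
      exact hH_le y
    · rw [Submodule.span_singleton_le_iff_mem]
      exact ⟨(0, 1), by simp [t]⟩
  have hlcA : ∀ v : H →₀ R, (∀ z, z ∉ A → v z = 0) → ((lc v : H) : F) ∈ L0 := by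
    intro v hv
    simp only [lc, Finsupp.linearCombination_apply, Finsupp.sum, id]
    rw [AddSubmonoidClass.coe_finsetSum]
    refine Submodule.sum_mem _ ?_
    intro z hz
    have hzA : z ∈ A := by
      by_contra h
      exact (Finsupp.mem_support_iff.1 hz) (hv z h)
    refine Submodule.smul_mem _ _ (Submodule.mem_sup_left (Submodule.subset_span ?_))
    simp only [Finset.coe_image, Set.mem_image]
    exact ⟨z, hzA, rfl⟩
  let τ : LinearMap.range t →ₗ[R] L0 :=
    ((LinearMap.range t).subtype - H.subtype.comp (lc.comp σ)).codRestrict L0 (by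
      rintro ⟨z, ⟨⟨h, r⟩, rfl⟩⟩
      have e : t (h, r) = (h : F) + r • w := by simp [t]
      have hm : (h : F) + r • w ∈ LinearMap.range t := ⟨(h, r), e⟩
      have e' : (⟨t (h, r), ⟨(h, r), rfl⟩⟩ : LinearMap.range t) = ⟨(h : F) + r • w, hm⟩ :=
        Subtype.ext e
      rw [e']
      simp only [LinearMap.sub_apply, LinearMap.comp_apply, hσ, Submodule.subtype_apply]
      have e2 : (h : F) = ((lc (s h) : H) : F) := by rw [hs']
      have e3 : (h : F) + r • w - ((lc (ρ (s h)) : H) : F)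
          = ((lc (s h - ρ (s h)) : H) : F) + r • w := by
        rw [map_sub, hs']
        simp only [Submodule.coe_sub]
        abel
      rw [e3]
      refine Submodule.add_mem _ (hlcA _ ?_) ?_
      · intro z hz
        simp [hρ2 _ _ hz]
      · exact Submodule.smul_mem _ _
          (Submodule.mem_sup_right (Submodule.mem_span_singleton_self w)))
  let κ : (H →₀ R) →ₗ[R] LinearMap.range t :=
    (H.subtype.comp lc).codRestrict _ (fun v => hH_le (lc v))
  refine Module.Projective.of_split (M := (H →₀ R) × L0)
    (σ.prod τ) (κ.coprod (Submodule.inclusion hL0_le)) ?_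
  ext z
  change ((lc (σ z) : H) : F) + ((z : F) - ((lc (σ z) : H) : F)) = (z : F)
  abel

theorem aux_cover_tf {R : Type u} [CommRing R]
    (hsh : ∀ I : Ideal R, I.FG → Module.Projective R I)
    {P : ModuleCat.{u} R} {M : Type u} [AddCommGroup M] [Module R M] {φ : P →ₗ[R] M}
    (hφ : IsCover R (P1Class R) P M φ)
    (x : P) (a : R) (ha : ∀ y : R, a * y = 0 → y = 0) (hax : a • x = 0) (hx : φ x = 0) :
    x = 0 := by
  obtain ⟨h1, h2, h3⟩ := hφ
  have hq : ProjDimLE1 R (P ⧸ Submodule.span R {x}) := aux_quot_tors hsh h1 x a ha hax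
  have hle : Submodule.span R {x} ≤ LinearMap.ker φ := by
    rw [Submodule.span_singleton_le_iff_mem]; exact hx
  obtain ⟨h, hh⟩ := h2 (ModuleCat.of R (P ⧸ Submodule.span R {x})) hq
    ((Submodule.span R {x}).liftQ φ hle)
  have hb := h3 (h.comp (Submodule.mkQ (Submodule.span R {x}))) (by
    rw [← LinearMap.comp_assoc]
    refine (congrArg (fun k => LinearMap.comp k (Submodule.mkQ (Submodule.span R {x}))) hh).trans ?_
    exact Submodule.liftQ_mkQ _ _ _)
  apply hb.1
  rw [map_zero, LinearMap.comp_apply]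
  have : Submodule.mkQ (Submodule.span R {x}) x = 0 := by simp
  exact (congrArg h this).trans (map_zero h)

/-- If a lift of `1` to the cover of `R ⧸ J` is killed by `J` then `J` is projective. -/
theorem aux_split {R : Type u} [CommRing R] (J : Ideal R) {P : Type u} [AddCommGroup P]
    [Module R P] (hP : ProjDimLE1 R P) (φ : P →ₗ[R] (R ⧸ J)) (p : P)
    (hp : φ p = Submodule.Quotient.mk 1) (hJ : ∀ r ∈ J, r • p = 0) : Module.Projective R J := by
  let i : (R ⧸ J) →ₗ[R] P := Submodule.liftQ J (LinearMap.toSpanSingleton R P p) (by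
    intro r hr
    simpa [LinearMap.mem_ker] using hJ r hr)
  have hi : ∀ m, φ (i m) = m := by
    intro m
    obtain ⟨r, rfl⟩ := Submodule.mkQ_surjective J m
    have : i (Submodule.mkQ J r) = r • p := rfl
    rw [this, map_smul, hp, ← Submodule.mkQ_apply, ← map_smul]
    simp
  have := aux_schanuel hP i φ hi (E := R) (Submodule.mkQ J) (Submodule.mkQ_surjective J)
  rwa [Submodule.ker_mkQ] at this

theorem aux_regular {R : Type u} [CommRing R]
    (hsh : ∀ I : Ideal R, I.FG → Module.Projective R I)
    (hcov : IsCoveringClass R (P1Class R)) (J : Ideal R) (a : R) (haJ : a ∈ J)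
    (ha : ∀ y : R, a * y = 0 → y = 0) : Module.Projective R J := by
  obtain ⟨P, φ, hφ⟩ := hcov (ModuleCat.of R (R ⧸ J))
  have hle : Ideal.span {a} ≤ J := by
    rw [Ideal.span_le]; simpa using haJ
  obtain ⟨h, hh⟩ := hφ.2.1 (ModuleCat.of R (R ⧸ Ideal.span {a}))
    (aux_p1_quot _ (hsh _ ⟨{a}, by simp [Ideal.span]⟩))
    (Submodule.factor hle)
  let p : P := h (Submodule.Quotient.mk (1 : R))
  have hap : ∀ r ∈ Ideal.span {a}, r • p = 0 := by
    intro r hr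
    have : r • (Submodule.Quotient.mk (1 : R) : R ⧸ Ideal.span {a}) = 0 := by
      rw [← Submodule.Quotient.mk_smul, Submodule.Quotient.mk_eq_zero]
      simpa using hr
    exact (map_smul h r _).symm.trans ((congrArg h this).trans (map_zero h))
  have hp : φ p = (Submodule.Quotient.mk 1 : R ⧸ J) := LinearMap.congr_fun hh _
  refine aux_split J hφ.1 φ p hp ?_
  intro r hr
  refine aux_cover_tf hsh hφ (r • p) a ha ?_ ?_
  · rw [smul_comm, hap a (Ideal.mem_span_singleton_self a), smul_zero]
  · rw [map_smul, hp]
    refine (Submodule.Quotient.mk_smul J r (1 : R)).symm.trans ?_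
    rw [Submodule.Quotient.mk_eq_zero]
    simpa using hr

theorem aux_idem {R : Type u} [CommRing R]
    (hcov : IsCoveringClass R (P1Class R)) (I : Ideal R)
    (hI : ∀ x ∈ I, ∃ e ∈ I, e * e = e ∧ e * x = x) : Module.Projective R I := by
  obtain ⟨P, φ, hφ⟩ := hcov (ModuleCat.of R (R ⧸ I))
  obtain ⟨h, hh⟩ := hφ.2.1 (ModuleCat.of R R)
    (aux_p1_of_proj (E := R) LinearMap.id Function.surjective_id (by
      rw [LinearMap.ker_id]; infer_instance))
    (Submodule.mkQ I)
  have hp : φ (h (1 : R)) = (Submodule.Quotient.mk 1 : R ⧸ I) := LinearMap.congr_fun hh _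
  refine aux_split I hφ.1 φ (h (1 : R)) hp ?_
  intro x hx
  obtain ⟨e, heI, hee, hex⟩ := hI x hx
  have he0 : ∀ m : R ⧸ I, e • m = 0 := by
    intro m
    obtain ⟨r, rfl⟩ := Submodule.mkQ_surjective I m
    rw [← map_smul, Submodule.mkQ_apply, Submodule.Quotient.mk_eq_zero]
    exact I.mul_mem_right _ heI
  have hb := hφ.2.2 (LinearMap.id - e • LinearMap.id) (by
    ext z
    have : φ (e • z) = 0 := (map_smul φ e z).trans (he0 _)
    simp [this])
  have hk : ∀ z : P, e • z = 0 := by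
    intro z
    apply hb.1
    change e • z - e • (e • z) = (0 : P) - e • (0 : P)
    rw [smul_smul, hee, sub_self, smul_zero, sub_zero]
  rw [← hex, mul_comm, mul_smul, hk, smul_zero]

theorem aux_pp {R : Type u} [CommRing R]
    (hsh : ∀ I : Ideal R, I.FG → Module.Projective R I) (r : R) :
    ∃ e : R, e * e = e ∧ e * r = r ∧ ∀ y, y * r = 0 → y * e = 0 := by
  have hp : Module.Projective R (LinearMap.range (LinearMap.toSpanSingleton R R r)) := by
    refine hsh _ ?_
    rw [LinearMap.range_toSpanSingleton]
    exact Submodule.fg_span_singleton r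
  obtain ⟨s, hs⟩ := LinearMap.exists_rightInverse_of_surjective
    (LinearMap.toSpanSingleton R R r).rangeRestrict (LinearMap.range_rangeRestrict _)
  have hm : ∀ y, y * r ∈ LinearMap.range (LinearMap.toSpanSingleton R R r) :=
    fun y => ⟨y, by simp⟩
  let r' : LinearMap.range (LinearMap.toSpanSingleton R R r) := ⟨r, by simpa using hm 1⟩
  have h1 : s r' * r = r := by
    have := congrArg Subtype.val (LinearMap.congr_fun hs r')
    simpa [r'] using this
  have h2 : ∀ y, y * s r' = s ⟨y * r, hm y⟩ := by
    intro y
    rw [← smul_eq_mul, ← map_smul]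
    rfl
  refine ⟨s r', ?_, h1, ?_⟩
  · rw [h2]
    congr 1
    exact Subtype.ext h1
  · intro y hy
    rw [h2]
    have : (⟨y * r, hm y⟩ : LinearMap.range (LinearMap.toSpanSingleton R R r)) = 0 :=
      Subtype.ext hy
    rw [this, map_zero]

theorem aux_ideal {R : Type u} [CommRing R]
    (hsh : ∀ I : Ideal R, I.FG → Module.Projective R I)
    (hcov : IsCoveringClass R (P1Class R)) (J : Ideal R) : Module.Projective R J := by
  classical
  let G : R → Prop := fun e => e * e = e ∧ ∃ r ∈ J, e * r = r ∧ ∀ y, y * r = 0 → y * e = 0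
  have hjoin : ∀ e f, G e → G f → G (e + f - e * f) := by
    rintro e f ⟨he, r, hr, her, hre⟩ ⟨hf, t, htJ, hft, htf⟩
    refine ⟨by linear_combination (1 - 2 * f + f * f) * he + (1 - e) * hf, r + (1 - e) * t,
      J.add_mem hr (J.mul_mem_left _ htJ), ?_, ?_⟩
    · linear_combination (1 - f) * her + (1 - e) * (1 - e) * hft
    · intro y hy
      have h1 : y * r = 0 := by
        linear_combination e * hy + (y * t) * he - y * her
      have h2 : y * e = 0 := hre y h1
      have h3 : y * t = 0 := by linear_combination hy - h1 + t * h2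
      have h4 : y * f = 0 := htf y h3
      linear_combination (1 - f) * h2 + h4
  have h0 : G 0 := ⟨by simp, 0, J.zero_mem, by simp, by simp⟩
  let I : Ideal R := Ideal.span {e | G e}
  have hGI : ∀ e, G e → e ∈ I := fun e he => Ideal.subset_span he
  have hI : ∀ x ∈ I, ∃ e, G e ∧ e * x = x := by
    intro x hx
    induction hx using Submodule.span_induction with
    | mem x hx => exact ⟨x, hx, hx.1⟩
    | zero => exact ⟨0, h0, by simp⟩
    | add x y _ _ hx hy =>
      obtain ⟨e, he, hex⟩ := hx
      obtain ⟨f, hf, hfy⟩ := hy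
      refine ⟨_, hjoin e f he hf, ?_⟩
      linear_combination (1 - f) * hex + (1 - e) * hfy
    | smul c x _ hx =>
      obtain ⟨e, he, hex⟩ := hx
      refine ⟨e, he, ?_⟩
      rw [smul_eq_mul]
      linear_combination c * hex
  have hIp : Module.Projective R I := aux_idem hcov I (fun x hx => by
    obtain ⟨e, he, hex⟩ := hI x hx
    exact ⟨e, hGI e he, he.1, hex⟩)
  have hJI : ∀ y ∈ J, ∃ e ∈ I, e * y = y := by
    intro y hy
    obtain ⟨e, hee, hey, hye⟩ := aux_pp hsh y
    exact ⟨e, hGI e ⟨hee, y, hy, hey, hye⟩, hey⟩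
  have hJleI : J ≤ I := by
    intro y hy
    obtain ⟨e, he, hey⟩ := hJI y hy
    rw [← hey]
    exact I.mul_mem_right _ he
  obtain ⟨s, hs⟩ := Module.projective_def'.1 hIp
  have hs' : ∀ y, Finsupp.linearCombination R (id : I → I) (s y) = y :=
    fun y => LinearMap.congr_fun hs y
  have hsJ : ∀ (y : J) (x : I), s (Submodule.inclusion hJleI y) x ∈ J := by
    intro y x
    obtain ⟨e, he, hey⟩ := hJI y y.2
    have : Submodule.inclusion hJleI y = (y : R) • (⟨e, he⟩ : I) := by
      ext
      simp [mul_comm (y : R) e, hey]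
    rw [this, map_smul, Finsupp.smul_apply, smul_eq_mul]
    exact J.mul_mem_right _ y.2
  let σ : J →ₗ[R] (I →₀ J) :=
    { toFun := fun y => Finsupp.onFinset (s (Submodule.inclusion hJleI y)).support
        (fun x => ⟨s (Submodule.inclusion hJleI y) x, hsJ y x⟩) (by
          intro x hx
          rw [Finsupp.mem_support_iff]
          intro h
          exact hx (Subtype.ext h))
      map_add' := by
        intro y z
        ext x
        simp
      map_smul' := by
        intro c y
        ext x
        simp }
  choose e heG hex using fun x : I => hI x x.2
  let J' : I → Ideal R := fun x => J ⊔ Ideal.span {1 - e x}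
  have hJ'p : ∀ x, Module.Projective R (J' x) := by
    intro x
    obtain ⟨hee, r, hr, her, hre⟩ := heG x
    refine aux_regular hsh hcov (J' x) (r + (1 - e x))
      (Ideal.add_mem _ (Ideal.mem_sup_left hr)
        (Ideal.mem_sup_right (Ideal.mem_span_singleton_self _))) ?_
    intro y hy
    have h1 : y * r = 0 := by linear_combination e x * hy + y * hee - y * her
    have h2 := hre y h1
    linear_combination hy - h1 + h2
  let μ : ∀ x : I, J' x →ₗ[R] J := fun x =>
    ((LinearMap.mulRight R (x : R)).comp (J' x).subtype).codRestrict J (by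
      rintro ⟨z, hz⟩
      obtain ⟨j, hj, t, ht, rfl⟩ := Submodule.mem_sup.1 hz
      obtain ⟨c, rfl⟩ := Ideal.mem_span_singleton'.1 ht
      have : (j + c * (1 - e x)) * (x : R) = j * x := by
        linear_combination - c * hex x
      simp only [LinearMap.comp_apply, Submodule.subtype_apply, LinearMap.mulRight_apply, this]
      exact J.mul_mem_right _ hj)
  have hle : ∀ x, J ≤ J' x := fun x => le_sup_left
  have key : ∀ y : J, (Finsupp.lsum R (fun x => (μ x).comp (Submodule.inclusion (hle x)))) (σ y)
      = y := by
    intro y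
    have h1 := hs' (Submodule.inclusion hJleI y)
    have h2 := congrArg Subtype.val h1
    ext
    rw [Finsupp.linearCombination_apply, Finsupp.sum, AddSubmonoidClass.coe_finsetSum] at h2
    rw [Finsupp.lsum_apply, Finsupp.sum_of_support_subset (s := (s (Submodule.inclusion hJleI y)).support),
      AddSubmonoidClass.coe_finsetSum]
    · refine Eq.trans ?_ h2
      refine Finset.sum_congr rfl ?_
      intro x _
      simp [σ, μ]
    · intro x hx
      rw [Finsupp.mem_support_iff] at hx ⊢
      intro h
      exact hx (Subtype.ext h)
    · intro x _
      simp
  refine Module.Projective.of_lifting_property'' ?_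
  intro f hf
  choose k hk using fun x : I => Module.projective_lifting_property f (μ x) hf
  refine ⟨(Finsupp.lsum R (fun x => (k x).comp (Submodule.inclusion (hle x)))).comp σ, ?_⟩
  have h3 : f.comp (Finsupp.lsum R (fun x => (k x).comp (Submodule.inclusion (hle x))))
      = Finsupp.lsum R (fun x => (μ x).comp (Submodule.inclusion (hle x))) := by
    refine Finsupp.lhom_ext' ?_
    intro x
    ext1 z
    have := LinearMap.congr_fun (hk x) (Submodule.inclusion (hle x) z)
    simpa using this
  rw [← LinearMap.comp_assoc, h3]
  ext1 y
  exact key y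

theorem aux_hereditary {R : Type u} [CommRing R]
    (hI : ∀ I : Ideal R, Module.Projective R I) {F : Type u} [AddCommGroup F] [Module R F]
    [Module.Projective R F] (N : Submodule R F) : Module.Projective R N := by
  refine Module.Projective.of_lifting_property ?_
  intro A B _ _ _ _ f g hf
  obtain ⟨⟨E, hE, i, hi⟩⟩ := CategoryTheory.EnoughInjectives.presentation (ModuleCat.of R A)
  have hEi : Module.Injective R E := Module.injective_module_of_injective_object R E
  have hEb : Module.Baer R E := Module.Baer.of_injective hEi
  let ι : A →ₗ[R] E := i.hom
  have hι : Function.Injective ι := (ModuleCat.mono_iff_injective i).1 hi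
  let Z : Submodule R E := (LinearMap.ker f).map ι
  have hQ : Module.Baer R (E ⧸ Z) := by
    intro I u
    have := hI I
    obtain ⟨v, hv⟩ := Module.projective_lifting_property (Submodule.mkQ Z) u
      (Submodule.mkQ_surjective Z)
    obtain ⟨w, hw⟩ := hEb I v
    refine ⟨(Submodule.mkQ Z).comp w, ?_⟩
    intro x hx
    rw [LinearMap.comp_apply, hw x hx]
    exact LinearMap.congr_fun hv _
  let β : B →ₗ[R] (E ⧸ Z) :=
    (Submodule.mapQ (LinearMap.ker f) Z ι (Submodule.le_comap_map _ _)).comp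
      (f.quotKerEquivOfSurjective hf).symm.toLinearMap
  have hβ : ∀ a, β (f a) = Submodule.mkQ Z (ι a) := by
    intro a
    have : (f.quotKerEquivOfSurjective hf).symm (f a) = Submodule.Quotient.mk a := by
      rw [LinearEquiv.symm_apply_eq]; rfl
    simp only [β, LinearMap.comp_apply, LinearEquiv.coe_coe, this]
    rfl
  have hβi : ∀ b, β b = 0 → b = 0 := by
    intro b hb
    obtain ⟨a, rfl⟩ := hf b
    rw [hβ, Submodule.mkQ_apply, Submodule.Quotient.mk_eq_zero] at hb
    obtain ⟨a', ha', h⟩ := hb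
    rw [← hι h]
    exact ha'
  obtain ⟨u, hu⟩ := hQ.injective.out N.subtype N.injective_subtype (β.comp g)
  obtain ⟨v, hv⟩ := Module.projective_lifting_property (Submodule.mkQ Z) u
    (Submodule.mkQ_surjective Z)
  have hvn : ∀ n : N, Submodule.mkQ Z (v n) = β (g n) := fun n =>
    (LinearMap.congr_fun hv _).trans (hu n)
  have hrange : ∀ n : N, v n ∈ LinearMap.range ι := by
    intro n
    obtain ⟨a, ha⟩ := hf (g n)
    have h1 := hvn n
    rw [← ha, hβ, ← sub_eq_zero, ← map_sub, Submodule.mkQ_apply,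
      Submodule.Quotient.mk_eq_zero] at h1
    obtain ⟨a', _, h⟩ := h1
    exact ⟨a' + a, by rw [map_add, h]; abel⟩
  refine ⟨(LinearEquiv.ofInjective ι hι).symm.toLinearMap.comp
    ((v.comp N.subtype).codRestrict (LinearMap.range ι) hrange), ?_⟩
  ext n
  set a := ((LinearEquiv.ofInjective ι hι).symm.toLinearMap.comp
    ((v.comp N.subtype).codRestrict (LinearMap.range ι) hrange)) n with ha
  have hιa : ι a = v n := by
    have : LinearEquiv.ofInjective ι hι a
        = ((v.comp N.subtype).codRestrict (LinearMap.range ι) hrange) n := by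
      rw [ha]; simp
    exact congrArg Subtype.val this
  rw [LinearMap.comp_apply, ← ha, ← sub_eq_zero]
  apply hβi
  rw [map_sub, hβ, hιa, hvn, sub_self]

/-- **Theorem 6.8 (Main theorem).** Let `R` be a commutative semihereditary ring such
that `𝒫₁(R)` is covering. Then `R` is hereditary (every ideal is projective);
consequently `𝒫₁(R) = Mod-R` and `𝒫₁(R)` is closed under direct limits. -/
theorem sh_covering_implies_hereditary (R : Type u) [CommRing R]
    (hsh : ∀ I : Ideal R, I.FG → Module.Projective R I)
    (hcov : IsCoveringClass R (P1Class R)) :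
    (∀ I : Ideal R, Module.Projective R I) ∧
    (∀ M : ModuleCat.{u} R, ProjDimLE1 R (M : Type u)) ∧
    (∀ M : ModuleCat.{u} R,
      IsDirectLimitOf R (P1Class R) (M : Type u) → ProjDimLE1 R (M : Type u)) := by
  have h1 : ∀ I : Ideal R, Module.Projective R I := fun I => aux_ideal hsh hcov I
  have h2 : ∀ M : ModuleCat.{u} R, ProjDimLE1 R (M : Type u) := fun M =>
    aux_p1_of_proj (E := (M →₀ R)) (Finsupp.linearCombination R (id : M → M))
      (Finsupp.linearCombination_surjective R Function.surjective_id)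
      (aux_hereditary h1 _)
  exact ⟨h1, h2, fun M _ => h2 M⟩
end
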